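/- For every b ∈ Λ(n,κ): (a) v_b H_{r,n} ≅ (v_b H_{r,p,n}) ⊗_{H_{r,p,n}} H_{r,n} as H_{r,n}-modules; (b) the restriction of v_b H_{r,n} to H_{r,p,n} is isomorphic to (v_b H_{r,p,n})^{⊕p}; (c) ((v_b H_{r,n})↓_{H_{r,p,n}}) ⊗_{H_{r,p,n}} H_{r,n} ≅ (v_b H_{r,n})^{⊕p} as H_{r,n}-modules. -/

import Mathlib

noncomputable section
namespace HuMathas

open scoped BigOperators
open scoped Classical

/-! ## The Ariki–Koike algebra presentation -/

variable (K : Type) [CommRing K]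

/-- The defining relations of the Ariki–Koike algebra `H_{r,n}(Q)` (with `r = p t`),
with generators `T_0, …, T_{n-1}` indexed by `Fin n`. -/
inductive AKRel (q : K) (p : ℕ) {t : ℕ} (Q : Fin t → K) (n : ℕ) :
    FreeAlgebra K (Fin n) → FreeAlgebra K (Fin n) → Prop
  | cyclo (h0 : 0 < n) :
      AKRel q p Q n
        (((List.finRange t).map (fun k => FreeAlgebra.ι K (⟨0, h0⟩ : Fin n) ^ p - algebraMap K _ (Q k ^ p))).prod) 0
  | braid01 (h1 : 1 < n) :
      AKRel q p Q n
        (FreeAlgebra.ι K (⟨0, by omega⟩ : Fin n) * FreeAlgebra.ι K (⟨1, h1⟩ : Fin n) *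
            FreeAlgebra.ι K (⟨0, by omega⟩ : Fin n) * FreeAlgebra.ι K (⟨1, h1⟩ : Fin n))
        (FreeAlgebra.ι K (⟨1, h1⟩ : Fin n) * FreeAlgebra.ι K (⟨0, by omega⟩ : Fin n) *
            FreeAlgebra.ι K (⟨1, h1⟩ : Fin n) * FreeAlgebra.ι K (⟨0, by omega⟩ : Fin n))
  | quad (i : ℕ) (hi : 1 ≤ i) (hn : i < n) :
      AKRel q p Q n
        ((FreeAlgebra.ι K (⟨i, hn⟩ : Fin n) + 1) *
          (FreeAlgebra.ι K (⟨i, hn⟩ : Fin n) - algebraMap K _ q)) 0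
  | braid (i : ℕ) (hi : 1 ≤ i) (hn : i + 1 < n) :
      AKRel q p Q n
        (FreeAlgebra.ι K (⟨i, by omega⟩ : Fin n) * FreeAlgebra.ι K (⟨i + 1, hn⟩ : Fin n) *
            FreeAlgebra.ι K (⟨i, by omega⟩ : Fin n))
        (FreeAlgebra.ι K (⟨i + 1, hn⟩ : Fin n) * FreeAlgebra.ι K (⟨i, by omega⟩ : Fin n) *
            FreeAlgebra.ι K (⟨i + 1, hn⟩ : Fin n))
  | comm (i j : ℕ) (hij : i + 1 < j) (hj : j < n) :
      AKRel q p Q n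
        (FreeAlgebra.ι K (⟨i, by omega⟩ : Fin n) * FreeAlgebra.ι K (⟨j, hj⟩ : Fin n))
        (FreeAlgebra.ι K (⟨j, hj⟩ : Fin n) * FreeAlgebra.ι K (⟨i, by omega⟩ : Fin n))

/-- The Ariki–Koike algebra `H_{r,n}(Q)` of type `G(r,1,n)` where `r = p * t`,
presented by generators `T_0, …, T_{n-1}` and the relations `AKRel`. -/
def AK (q : K) (p : ℕ) {t : ℕ} (Q : Fin t → K) (n : ℕ) : Type :=
  RingQuot (AKRel K q p Q n)

instance (q : K) (p : ℕ) {t : ℕ} (Q : Fin t → K) (n : ℕ) : Ring (AK K q p Q n) :=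
  inferInstanceAs (Ring (RingQuot (AKRel K q p Q n)))

instance (q : K) (p : ℕ) {t : ℕ} (Q : Fin t → K) (n : ℕ) : Algebra K (AK K q p Q n) :=
  inferInstanceAs (Algebra K (RingQuot (AKRel K q p Q n)))

section ops
variable (q : K) (p : ℕ) {t : ℕ} (Q : Fin t → K) (n : ℕ)

/-- The generator `T_i` of the Ariki–Koike algebra, for `0 ≤ i ≤ n-1` (and junk value `1`
for `i ≥ n`). -/
def Tg (i : ℕ) : AK K q p Q n :=
  if h : i < n then RingQuot.mkAlgHom K (AKRel K q p Q n) (FreeAlgebra.ι K ⟨i, h⟩) else 1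

/-- The Murphy elements `L_k` (`1 ≤ k ≤ n`), defined by `L_1 = T_0` and
`L_{k+1} = q⁻¹ T_k L_k T_k`;  `L_0` is a junk value. -/
def Lm : ℕ → AK K q p Q n
  | 0 => 1
  | 1 => Tg K q p Q n 0
  | (k + 2) => Ring.inverse q • (Tg K q p Q n (k + 1) * Lm (k + 1) * Tg K q p Q n (k + 1))

/-- The product `T_{i_1} ⋯ T_{i_k}` attached to a word `[i_1, …, i_k]`. -/
def Tword (l : List ℕ) : AK K q p Q n := (l.map (Tg K q p Q n)).prod

/-- The simple transposition `s_i = (i, i+1)` of `{1, …, n} ⊆ ℕ` (junk value `1` unless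
`1 ≤ i ≤ n - 1`). -/
def sswap (i : ℕ) : Equiv.Perm ℕ :=
  if 1 ≤ i ∧ i < n then Equiv.swap i (i + 1) else 1

/-- The permutation of `{1, …, n}` attached to a word in the simple transpositions, where the
letters of the word act in order from left to right (i.e. `s_{i_1}` acts first). -/
def wordPerm (l : List ℕ) : Equiv.Perm ℕ := ((l.map (sswap n)).reverse).prod

/-- `w` is a permutation of `{1, …, n} ⊆ ℕ`, i.e. it fixes everything outside `{1, …, n}`. -/
def IsSnPerm (w : Equiv.Perm ℕ) : Prop := ∀ k : ℕ, (k = 0 ∨ n < k) → w k = k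

/-- `l` is a reduced word for `w ∈ S_n` in the simple transpositions `s_1, …, s_{n-1}`. -/
def IsReducedWordFor (w : Equiv.Perm ℕ) (l : List ℕ) : Prop :=
  (∀ i ∈ l, 1 ≤ i ∧ i < n) ∧ wordPerm n l = w ∧
    ∀ l' : List ℕ, ((∀ i ∈ l', 1 ≤ i ∧ i < n) ∧ wordPerm n l' = w) → l.length ≤ l'.length

/-- The element `T_w` for `w ∈ S_n`, defined via a (choice of) reduced word for `w`; this is
well defined because the braid relations hold in the Ariki–Koike algebra. -/
def Tw (w : Equiv.Perm ℕ) : AK K q p Q n :=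
  if h : ∃ l : List ℕ, IsReducedWordFor n w l then Tword K q p Q n (Classical.choose h) else 0

/-- The element `T_w^* = T_{i_k} ⋯ T_{i_1}`, the image of `T_w` under the anti-automorphism `*`
of the Ariki–Koike algebra which fixes each generator `T_i`. -/
def Twstar (w : Equiv.Perm ℕ) : AK K q p Q n :=
  if h : ∃ l : List ℕ, IsReducedWordFor n w l then
    Tword K q p Q n (Classical.choose h).reverse else 0

/-- The monomial `L_1^{c_1} ⋯ L_n^{c_n}` in the Murphy elements. -/
def Lmono (c : ℕ → ℕ) : AK K q p Q n := (((List.range n).map (fun i => Lm K q p Q n (i + 1) ^ c (i + 1))).prod)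

/-- The cyclotomic Hecke algebra `H_{r,p,n}(Q)` of type `G(r,p,n)`: the subalgebra of
`H_{r,n}(Q)` generated by `T_0^p`, `T_0⁻¹ T_1 T_0` and `T_1, …, T_{n-1}`. -/
def AKp : Subalgebra K (AK K q p Q n) :=
  Algebra.adjoin K
    ({Tg K q p Q n 0 ^ p, Ring.inverse (Tg K q p Q n 0) * Tg K q p Q n 1 * Tg K q p Q n 0} ∪
      {x | ∃ i : ℕ, 1 ≤ i ∧ i < n ∧ x = Tg K q p Q n i})

/-- The automorphism `σ` of `H_{r,n}(Q)` with `σ(T_0) = ε T_0` and `σ(T_i) = T_i` for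
`i ≥ 1`; it is the unique algebra automorphism with these values on the generators. -/
def sigmaAut (ε : K) : AK K q p Q n ≃ₐ[K] AK K q p Q n :=
  if h : ∃ f : AK K q p Q n ≃ₐ[K] AK K q p Q n,
      f (Tg K q p Q n 0) = ε • Tg K q p Q n 0 ∧ ∀ i : ℕ, 1 ≤ i → f (Tg K q p Q n i) = Tg K q p Q n i
  then Classical.choose h else AlgEquiv.refl

/-- The automorphism `τ` of `H_{r,n}(Q)` given by `τ(h) = T_0⁻¹ h T_0` (as a function). -/
def tauMap (x : AK K q p Q n) : AK K q p Q n :=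
  Ring.inverse (Tg K q p Q n 0) * x * Tg K q p Q n 0

end ops

end HuMathas
open scoped Classical
namespace HuMathas

section vb
variable (K : Type) [CommRing K]
variable (q : K) (p : ℕ) {tt : ℕ} (Q : Fin tt → K) (n : ℕ) (κ : ℕ) (t_ : Fin κ → ℕ)

/-- The parameter `Q_k` (1-based indexing, junk value `0` outside `1 ≤ k ≤ t`). -/
def Qat (k : ℕ) : K := if h : 1 ≤ k ∧ k ≤ tt then Q ⟨k - 1, by omega⟩ else 0

/-- `t_α` for `1 ≤ α ≤ κ` (1-based indexing, junk value `0` otherwise). -/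
def tat (α : ℕ) : ℕ := if h : 1 ≤ α ∧ α ≤ κ then t_ ⟨α - 1, by omega⟩ else 0

/-- `t_{1..α} = t_1 + ⋯ + t_α`. -/
def tsum (α : ℕ) : ℕ := ∑ β ∈ Finset.Icc 1 α, tat κ t_ β

/-- The sub-tuple `Q_α = (Q_{t_{1..α-1}+1}, …, Q_{t_{1..α}})` of `Q`. -/
def Qsub (α : ℕ) : Fin (tat κ t_ α) → K :=
  fun i => Qat K Q (tsum κ t_ (α - 1) + i.val + 1)

/-- `Q_i` and `Q_j` lie in the same `(ε,q)`-orbit only if they lie in the same part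
`Q_α` of the partition of `Q` determined by `t_`.  (Here `K` must be a field for `zpow`.) -/
def OrbitPartition {K : Type} [Field K] (ε q : K) {tt : ℕ} (Q : Fin tt → K)
    (κ : ℕ) (t_ : Fin κ → ℕ) : Prop :=
  (tsum κ t_ κ = tt) ∧
  ∀ α β i j : ℕ, 1 ≤ α → α ≤ κ → 1 ≤ β → β ≤ κ →
    tsum κ t_ (α - 1) < i → i ≤ tsum κ t_ α →
    tsum κ t_ (β - 1) < j → j ≤ tsum κ t_ β →
    (∃ a b : ℤ, Qat K Q i = ε ^ a * q ^ b * Qat K Q j) → α = β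

variable (b : Fin κ → ℕ)

/-- `b_α` for `1 ≤ α ≤ κ` (1-based indexing, junk value `0` otherwise). -/
def bat (α : ℕ) : ℕ := if h : 1 ≤ α ∧ α ≤ κ then b ⟨α - 1, by omega⟩ else 0

/-- `b_{1..α} = b_1 + ⋯ + b_α`. -/
def bsum (α : ℕ) : ℕ := ∑ β ∈ Finset.Icc 1 α, bat κ b β

/-- `b_{α..κ} = b_α + ⋯ + b_κ`. -/
def bsumFrom (α : ℕ) : ℕ := ∑ β ∈ Finset.Icc α κ, bat κ b β

/-- `b` is a composition of `n` into `κ` non-negative parts, i.e. `b ∈ Λ(n,κ)`. -/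
def IsComp : Prop := bsum κ b κ = n

/-- The word `(s_{a+b-1} ⋯ s_1)^b` representing the permutation `w_{a,b}`. -/
def wabWord (a c : ℕ) : List ℕ :=
  (List.replicate c ((List.range' 1 (a + c - 1)).reverse)).flatten

/-- The permutation `w_{a,b} = (s_{a+b-1} ⋯ s_1)^b` of `{1, …, n}`. -/
def wabPerm (a c : ℕ) : Equiv.Perm ℕ := wordPerm n (wabWord a c)

/-- `v^+_{a,b}(s) = ∏_{k=1}^{s} (L_1^p - Q_k^p) ⋯ (L_a^p - Q_k^p) · T_{w_{a,b}}`. -/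
def vplus (a c s : ℕ) : AK K q p Q n :=
  (((List.range s).map (fun k0 =>
      ((List.range a).map (fun m0 =>
        Lm K q p Q n (m0 + 1) ^ p - algebraMap K _ (Qat K Q (k0 + 1) ^ p))).prod)).prod) *
    Tword K q p Q n (wabWord a c)

/-- `u^+_{ω_b} = ∏_{α=1}^{κ-1} ∏_{k=t_{1..α}+1}^{t_{1..α+1}} (L_1^p - Q_k^p) ⋯ (L_{b_{1..α}}^p - Q_k^p)`. -/
def uplusOmega : AK K q p Q n :=
  (((List.range (κ - 1)).map (fun α0 =>
      ((List.range (tsum κ t_ (α0 + 2) - tsum κ t_ (α0 + 1))).map (fun k0 =>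
        ((List.range (bsum κ b (α0 + 1))).map (fun m0 =>
          Lm K q p Q n (m0 + 1) ^ p -
            algebraMap K _ (Qat K Q (tsum κ t_ (α0 + 1) + k0 + 1) ^ p))).prod)).prod)).prod)

/-- `v_b^- = ∏_{α=κ}^{2} ∏_{i=1}^{t_{1..α-1}} (L_1^p - Q_i^p) ⋯ (L_{b_α}^p - Q_i^p) ·
T_{w_{b_α, b_{1..α-1}}}`, with `α` decreasing from left to right. -/
def vbMinus : AK K q p Q n :=
  ((List.range (κ - 1)).map (fun idx =>
    vplus K q p Q n (bat κ b (κ - idx)) (bsum κ b (κ - idx - 1)) (tsum κ t_ (κ - idx - 1)))).prod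

/-- The element `v_b = v^+_{b_κ, b_{1..κ-1}}(t_{1..κ-1}) ⋯ v^+_{b_2, b_1}(t_1) · u^+_{ω_b}`. -/
def vb : AK K q p Q n :=
  vbMinus K q p Q n κ t_ b * uplusOmega K q p Q n κ t_ b

/-- The permutation `w_b = w_{b_κ, b_{1..κ-1}} w_{b_{κ-1}, b_{1..κ-2}} ⋯ w_{b_2, b_1}`. -/
def wbPerm : Equiv.Perm ℕ :=
  wordPerm n (((List.range (κ - 1)).map (fun idx =>
    wabWord (bat κ b (κ - idx)) (bsum κ b (κ - idx - 1)))).flatten)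

/-- The right ideal `a · H` of `H = H_{r,n}(Q)`, as a submodule for the right regular action
(i.e. as a module over the opposite ring). -/
def rIdeal (a : AK K q p Q n) : Submodule (AK K q p Q n)ᵐᵒᵖ (AK K q p Q n) where
  carrier := {x | ∃ h : AK K q p Q n, x = a * h}
  add_mem' := by
    rintro x y ⟨h1, rfl⟩ ⟨h2, rfl⟩
    exact ⟨h1 + h2, by rw [mul_add]⟩
  zero_mem' := ⟨0, by rw [mul_zero]⟩
  smul_mem' := by
    rintro c x ⟨h, rfl⟩
    refine ⟨h * c.unop, ?_⟩
    rw [← MulOpposite.op_unop c, op_smul_eq_mul, MulOpposite.unop_op, mul_assoc]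

/-- The subspace `v · H_{r,p,n}(Q)` of `H_{r,n}(Q)`, as a `K`-submodule. -/
def vSubmoduleP (v : AK K q p Q n) : Submodule K (AK K q p Q n) :=
  Submodule.map (LinearMap.mulLeft K v) (Subalgebra.toSubmodule (AKp K q p Q n))

/-- The subspace `v · H_{r,n}(Q)` of `H_{r,n}(Q)`, as a `K`-submodule. -/
def vSubmodule (v : AK K q p Q n) : Submodule K (AK K q p Q n) :=
  LinearMap.range (LinearMap.mulLeft K v)

end vb
end HuMathas

namespace HuMathas
section blockProd
variable (K : Type) [CommRing K] (q : K) (p : ℕ) {tt : ℕ} (Q : Fin tt → K) (n : ℕ)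
variable (κ : ℕ) (t_ : Fin κ → ℕ)

/-- The product `∏_{Q_i ∈ Q_α} (L_m^p - Q_i^p)` over the `α`-th part of the partition of `Q`. -/
def LQblockProd (m α : ℕ) : AK K q p Q n :=
  ((List.range (tat κ t_ α)).map (fun i0 =>
    Lm K q p Q n m ^ p -
      algebraMap K _ (Qat K Q (tsum κ t_ (α - 1) + i0 + 1) ^ p))).prod

end blockProd
end HuMathas
namespace HuMathas

section genmod

/-- The type of linear maps between two modules with explicitly given module structures
(used to talk about restricted module structures without instance problems). -/
abbrev RLinMap (R : Type) [Ring R] (M N : Type) [AddCommGroup M] [AddCommGroup N]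
    (mM : Module R M) (mN : Module R N) : Type :=
  @LinearMap R R _ _ (RingHom.id R) M N _ _ mM mN

/-- The type of linear equivalences between two modules with explicitly given module
structures. -/
abbrev RLinEquiv (R : Type) [Ring R] (M N : Type) [AddCommGroup M] [AddCommGroup N]
    (mM : Module R M) (mN : Module R N) : Type :=
  @LinearEquiv R R _ _ (RingHom.id R) (RingHom.id R) RingHomInvPair.ids RingHomInvPair.ids
    M N _ _ mM mN

/-- `N` (a right `B`-module, given as a left module over `Bᵐᵒᵖ`) is the module induced from the
right `B'`-module `M` along the ring homomorphism `ι : B' →+* B`, i.e. `N ≅ M ⊗_{B'} B`;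
this is expressed by the universal property of induction (Frobenius reciprocity):  there is a
`B'`-linear map `u : M → N↓` such that every `B'`-linear map from `M` to the restriction of a
right `B`-module `P` factors uniquely through a `B`-linear map `N → P`. -/
def IsInducedFrom (B' B : Type) [Ring B'] [Ring B] (ι : B' →+* B)
    (M : Type) [AddCommGroup M] (mM : Module B'ᵐᵒᵖ M)
    (N : Type) [AddCommGroup N] (mN : Module Bᵐᵒᵖ N) : Prop :=
  letI := mN
  ∃ u : RLinMap B'ᵐᵒᵖ M N mM (Module.compHom N (RingHom.op ι)),
    ∀ (P : Type) (_ : AddCommGroup P) (mP : Module Bᵐᵒᵖ P),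
      ∀ f : RLinMap B'ᵐᵒᵖ M P mM (letI := mP; Module.compHom P (RingHom.op ι)),
        ∃! g : @LinearMap Bᵐᵒᵖ Bᵐᵒᵖ _ _ (RingHom.id Bᵐᵒᵖ) N P _ _ mN mP,
          ∀ m : M, g (u m) = f m

end genmod

end HuMathas
open scoped Classical
namespace HuMathas



section rmodAK
variable (K : Type) [CommRing K] (q : K) (p : ℕ) {tt : ℕ} (Q : Fin tt → K) (n : ℕ)

/-- The opposite of the inclusion `H_{r,p,n}(Q) ⊆ H_{r,n}(Q)`; restriction along this map
realizes a right `H_{r,n}`-module as a right `H_{r,p,n}`-module. -/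
def inclOp : (↥(AKp K q p Q n))ᵐᵒᵖ →+* (AK K q p Q n)ᵐᵒᵖ :=
  RingHom.op ((AKp K q p Q n).val.toRingHom)

/-- `H_{r,n}(Q)` as a right `H_{r,p,n}(Q)`-module. -/
instance AKpOpModule : Module (↥(AKp K q p Q n))ᵐᵒᵖ (AK K q p Q n) :=
  Module.compHom _ (inclOp K q p Q n)

/-- The right `H_{r,p,n}`-submodule `v · H_{r,p,n}` of `H_{r,n}`. -/
def rIdealP (v : AK K q p Q n) :
    Submodule (↥(AKp K q p Q n))ᵐᵒᵖ (AK K q p Q n) where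
  carrier := {x | ∃ h ∈ AKp K q p Q n, x = v * h}
  add_mem' := by
    rintro x y ⟨h1, hm1, rfl⟩ ⟨h2, hm2, rfl⟩
    exact ⟨h1 + h2, add_mem hm1 hm2, by rw [mul_add]⟩
  zero_mem' := ⟨0, zero_mem _, by rw [mul_zero]⟩
  smul_mem' := by
    rintro c x ⟨h, hm, rfl⟩
    refine ⟨h * (c.unop : AK K q p Q n), mul_mem hm c.unop.2, ?_⟩
    show (inclOp K q p Q n c) • (v * h) = _
    rw [← MulOpposite.op_unop (inclOp K q p Q n c), op_smul_eq_mul]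
    simp [inclOp, mul_assoc]

end rmodAK
end HuMathas

namespace HuMathas
section endspace
variable (K : Type) [CommRing K] (q : K) (p : ℕ) {tt : ℕ} (Q : Fin tt → K) (n : ℕ)

/-- For a `K`-subspace `V` of `H_{r,n}(Q)` which is stable under right multiplication by the
elements `h` satisfying `P h`, the space of `K`-linear endomorphisms of `V` commuting with all
right multiplications by such `h`.  Taking `P = ⊤` (resp. `P = (· ∈ H_{r,p,n})`) this is the
endomorphism algebra of `V` as a right `H_{r,n}`- (resp. `H_{r,p,n}`-) module, viewed as a
`K`-vector space. -/
def EndSpace (V : Submodule K (AK K q p Q n)) (P : AK K q p Q n → Prop) :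
    Submodule K (↥V →ₗ[K] ↥V) where
  carrier := {f | ∀ (x y : ↥V) (h : AK K q p Q n), P h →
    (y : AK K q p Q n) = (x : AK K q p Q n) * h →
      ((f y : AK K q p Q n)) = (f x : AK K q p Q n) * h}
  add_mem' := by
    intro f g hf hg x y h hP hxy
    simp only [LinearMap.add_apply, Submodule.coe_add,
      hf x y h hP hxy, hg x y h hP hxy, add_mul]
  zero_mem' := by
    intro x y h hP hxy
    simp [zero_mul]
  smul_mem' := by
    intro c f hf x y h hP hxy
    simp only [LinearMap.smul_apply, Submodule.coe_smul,
      hf x y h hP hxy, smul_mul_assoc]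

end endspace
end HuMathas

namespace HuMathas
section homspace
variable (K : Type) [CommRing K] (q : K) (p : ℕ) {tt : ℕ} (Q : Fin tt → K) (n : ℕ)

/-- For `K`-subspaces `V, W` of `H_{r,n}(Q)`, the space of `K`-linear maps `V → W` commuting
with right multiplication by all elements `h` with `P h`. -/
def HomSpace (V W : Submodule K (AK K q p Q n)) (P : AK K q p Q n → Prop) :
    Submodule K (↥V →ₗ[K] ↥W) where
  carrier := {f | ∀ (x y : ↥V) (h : AK K q p Q n), P h →
    (y : AK K q p Q n) = (x : AK K q p Q n) * h →
      ((f y : AK K q p Q n)) = (f x : AK K q p Q n) * h}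
  add_mem' := by
    intro f g hf hg x y h hP hxy
    simp only [LinearMap.add_apply, Submodule.coe_add,
      hf x y h hP hxy, hg x y h hP hxy, add_mul]
  zero_mem' := by
    intro x y h hP hxy
    simp [zero_mul]
  smul_mem' := by
    intro c f hf x y h hP hxy
    simp only [LinearMap.smul_apply, Submodule.coe_smul,
      hf x y h hP hxy, smul_mul_assoc]

end homspace

section progen

/-- A progenerator: a projective module containing every projective indecomposable module as
a direct summand. -/
def IsProgenerator (B V : Type) [Ring B] [AddCommGroup V] [Module B V] : Prop :=
  Module.Projective B V ∧
  ∀ (P : Type) (_ : AddCommGroup P) (mP : Module B P),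
    (letI := mP; Module.Projective B P) →
    (letI := mP; (⊥ : Submodule B P) ≠ ⊤) →
    (letI := mP; ∀ X Y : Submodule B P, X ⊓ Y = ⊥ → X ⊔ Y = ⊤ → X = ⊥ ∨ Y = ⊥) →
    (letI := mP; ∃ (inj : P →ₗ[B] V) (proj : V →ₗ[B] P), ∀ x, proj (inj x) = x)

end progen
end HuMathas

namespace HuMathas

section relations

variable {K : Type} [Field K] {q : K} {p : ℕ} {t : ℕ} {Q : Fin t → K} {n : ℕ}

local notation "𝕋" => Tg K q p Q n
local notation "𝕃" => Lm K q p Q n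

/-- The projection from the free algebra onto the Ariki–Koike algebra. -/
def AK.mk : FreeAlgebra K (Fin n) →ₐ[K] AK K q p Q n := RingQuot.mkAlgHom K (AKRel K q p Q n)

lemma AK.mk_rel {x y : FreeAlgebra K (Fin n)} (h : AKRel K q p Q n x y) :
    (AK.mk x : AK K q p Q n) = AK.mk y :=
  RingQuot.mkAlgHom_rel K h

lemma AK.mk_surjective : Function.Surjective (AK.mk : _ → AK K q p Q n) :=
  RingQuot.mkAlgHom_surjective K _

lemma AK.mk_ι (i : ℕ) (hi : i < n) : (AK.mk (FreeAlgebra.ι K ⟨i, hi⟩) : AK K q p Q n) = 𝕋 i :=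
  (dif_pos (c := i < n) (t := fun h => (AK.mk (FreeAlgebra.ι K ⟨i, h⟩) : AK K q p Q n))
    (e := fun _ => 1) hi).symm

lemma Tg_of_le {i : ℕ} (hi : n ≤ i) : 𝕋 i = 1 := by
  simp [Tg, Nat.not_lt.mpr hi]

lemma Tg_sq {i : ℕ} (h1 : 1 ≤ i) (hn : i < n) : 𝕋 i * 𝕋 i = (q - 1) • 𝕋 i + q • 1 := by
  have h := AK.mk_rel (AKRel.quad (q := q) (p := p) (Q := Q) i h1 hn)
  simp only [map_mul, map_add, map_sub, map_one, map_zero, AK.mk_ι, AlgHom.commutes] at h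
  rw [Algebra.algebraMap_eq_smul_one] at h
  have e : 𝕋 i * 𝕋 i = (𝕋 i + 1) * (𝕋 i - q • 1) + ((q - 1) • 𝕋 i + q • 1) := by
    simp only [add_mul, mul_sub, mul_smul_comm, mul_one, one_mul, sub_smul, one_smul,
      smul_add]
    abel
  rw [e, h, zero_add]

lemma Tg_braid {i : ℕ} (h1 : 1 ≤ i) (hn : i + 1 < n) :
    𝕋 i * 𝕋 (i + 1) * 𝕋 i = 𝕋 (i + 1) * 𝕋 i * 𝕋 (i + 1) := by
  have h := AK.mk_rel (AKRel.braid (q := q) (p := p) (Q := Q) i h1 hn)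
  simpa only [map_mul, AK.mk_ι] using h

lemma Tg_braid_zero (hn : 1 < n) : 𝕋 0 * 𝕋 1 * 𝕋 0 * 𝕋 1 = 𝕋 1 * 𝕋 0 * 𝕋 1 * 𝕋 0 := by
  have h := AK.mk_rel (AKRel.braid01 (q := q) (p := p) (Q := Q) hn)
  simpa only [map_mul, AK.mk_ι] using h

lemma Tg_commute_of_lt {i j : ℕ} (h : i + 1 < j) : Commute (𝕋 i) (𝕋 j) := by
  rcases lt_or_ge j n with hj | hj
  · have h := AK.mk_rel (AKRel.comm (q := q) (p := p) (Q := Q) i j h hj)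
    simpa only [map_mul, AK.mk_ι, commute_iff_eq] using h
  · rw [Tg_of_le hj]
    exact Commute.one_right _

lemma Tg_cyclo (hn : 0 < n) :
    ((List.finRange t).map (fun k => 𝕋 0 ^ p - algebraMap K _ (Q k ^ p))).prod = 0 := by
  have h := AK.mk_rel (AKRel.cyclo (q := q) (p := p) (Q := Q) hn)
  simpa only [map_list_prod, List.map_map, Function.comp_def, map_sub, map_pow, AK.mk_ι,
    AlgHom.commutes, map_zero] using h

lemma Tg_isUnit (hq : q ≠ 0) {i : ℕ} (hi : 1 ≤ i) : IsUnit (𝕋 i) := by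
  rcases lt_or_ge i n with hn | hn
  · have h : 𝕋 i * (𝕋 i - (q - 1) • 1) = q • 1 := by
      rw [mul_sub, Tg_sq hi hn, mul_smul_comm, mul_one]
      abel
    have h' : (𝕋 i - (q - 1) • 1) * 𝕋 i = q • 1 := by
      rw [sub_mul, Tg_sq hi hn, smul_mul_assoc, one_mul]
      abel
    refine ⟨⟨𝕋 i, q⁻¹ • (𝕋 i - (q - 1) • 1), ?_, ?_⟩, rfl⟩
    · rw [mul_smul_comm, h, smul_smul, inv_mul_cancel₀ hq, one_smul]
    · rw [smul_mul_assoc, h', smul_smul, inv_mul_cancel₀ hq, one_smul]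
  · rw [Tg_of_le hn]
    exact isUnit_one

lemma Lm_one : 𝕃 1 = 𝕋 0 := rfl

lemma Lm_succ {k : ℕ} (hk : 1 ≤ k) : 𝕃 (k + 1) = q⁻¹ • (𝕋 k * 𝕃 k * 𝕋 k) := by
  obtain ⟨k, rfl⟩ := Nat.exists_eq_add_of_le' hk
  simp only [Lm, Ring.inverse_eq_inv']

/-- The subalgebra generated by `T_0, …, T_{m-1}`. -/
def parabolic (K : Type) [Field K] (q : K) (p : ℕ) {t : ℕ} (Q : Fin t → K) (n m : ℕ) :
    Subalgebra K (AK K q p Q n) :=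
  Algebra.adjoin K {x | ∃ i < m, x = Tg K q p Q n i}

local notation "ℍ" => parabolic K q p Q n

lemma Tg_mem_parabolic {i m : ℕ} (h : i < m) : 𝕋 i ∈ ℍ m :=
  Algebra.subset_adjoin ⟨i, h, rfl⟩

lemma parabolic_mono {m m' : ℕ} (h : m ≤ m') : ℍ m ≤ ℍ m' :=
  Algebra.adjoin_mono fun _ ⟨i, hi, e⟩ => ⟨i, hi.trans_le h, e⟩

lemma parabolic_self : ℍ n = ⊤ := by
  rw [eq_top_iff]
  rintro x -
  obtain ⟨y, rfl⟩ := AK.mk_surjective x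
  induction y using FreeAlgebra.induction with
  | grade0 r => rw [AlgHom.commutes]; exact Subalgebra.algebraMap_mem _ _
  | grade1 i => rw [AK.mk_ι i.1 i.2]; exact Tg_mem_parabolic i.2
  | mul a b ha hb => rw [map_mul]; exact mul_mem ha hb
  | add a b ha hb => rw [map_add]; exact add_mem ha hb

lemma commute_of_mem_adjoin {A : Type} [Ring A] [Algebra K A] {s : Set A} {x y : A}
    (h : ∀ z ∈ s, Commute y z) (hx : x ∈ Algebra.adjoin K s) : Commute y x := by
  induction hx using Algebra.adjoin_induction with
  | mem z hz => exact h z hz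
  | algebraMap r => exact (Algebra.commutes r y).symm
  | add a b _ _ ha hb => exact ha.add_right hb
  | mul a b _ _ ha hb => exact ha.mul_right hb

lemma commute_of_mem_parabolic {m : ℕ} {x y : AK K q p Q n} (h : ∀ i < m, Commute y (𝕋 i))
    (hx : x ∈ ℍ m) : Commute y x :=
  commute_of_mem_adjoin (by rintro _ ⟨i, hi, rfl⟩; exact h i hi) hx

lemma Lm_mem_parabolic {k m : ℕ} (h1 : 1 ≤ k) (hm : k ≤ m) : 𝕃 k ∈ ℍ m := by
  induction k, h1 using Nat.le_induction with
  | base => exact Tg_mem_parabolic (by omega)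
  | succ k hk ih =>
    rw [Lm_succ hk]
    have hT : 𝕋 k ∈ ℍ m := Tg_mem_parabolic (by omega)
    exact Subalgebra.smul_mem _ (mul_mem (mul_mem hT (ih (by omega))) hT) _

lemma Lm_commute_Tg_of_lt {k i : ℕ} (h1 : 1 ≤ k) (hi : k < i) : Commute (𝕃 k) (𝕋 i) :=
  (commute_of_mem_parabolic (fun _ hj => (Tg_commute_of_lt (by omega)).symm)
    (Lm_mem_parabolic h1 le_rfl)).symm

lemma Lm_commute_Tg_of_gt {k i : ℕ} (hi : i + 1 < k) (hk : k ≤ n) : Commute (𝕃 k) (𝕋 i) := by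
  induction k with
  | zero => omega
  | succ k ih =>
    rw [Lm_succ (by omega)]
    refine Commute.smul_left ?_ _
    rcases Nat.lt_or_ge (i + 1) k with h | h
    · have hT : Commute (𝕋 k) (𝕋 i) := (Tg_commute_of_lt h).symm
      exact (hT.mul_left (ih h (by omega))).mul_left hT
    · obtain rfl : k = i + 1 := by omega
      rcases Nat.eq_zero_or_pos i with rfl | hi0
      · have := Tg_braid_zero (K := K) (q := q) (p := p) (Q := Q) (n := n) (by omega)
        simp only [zero_add, Lm_one]
        rw [commute_iff_eq, ← this]
        simp only [mul_assoc]
      · rw [Lm_succ hi0, mul_smul_comm, smul_mul_assoc]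
        refine Commute.smul_left ?_ _
        have hb := Tg_braid (K := K) (q := q) (p := p) (Q := Q) hi0 (by omega : i + 1 < n)
        have hc : 𝕃 i * 𝕋 (i + 1) = 𝕋 (i + 1) * 𝕃 i := Lm_commute_Tg_of_lt hi0 (by omega)
        rw [commute_iff_eq]
        calc 𝕋 (i + 1) * (𝕋 i * 𝕃 i * 𝕋 i) * 𝕋 (i + 1) * 𝕋 i
            = 𝕋 (i + 1) * 𝕋 i * 𝕃 i * (𝕋 i * 𝕋 (i + 1) * 𝕋 i) := by simp only [mul_assoc]
          _ = 𝕋 (i + 1) * 𝕋 i * (𝕃 i * 𝕋 (i + 1)) * 𝕋 i * 𝕋 (i + 1) := by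
            rw [hb]; simp only [mul_assoc]
          _ = (𝕋 (i + 1) * 𝕋 i * 𝕋 (i + 1)) * 𝕃 i * 𝕋 i * 𝕋 (i + 1) := by
            rw [hc]; simp only [mul_assoc]
          _ = 𝕋 i * (𝕋 (i + 1) * (𝕋 i * 𝕃 i * 𝕋 i) * 𝕋 (i + 1)) := by
            rw [← hb]; simp only [mul_assoc]

lemma Lm_commute_Lm_of_lt {j k : ℕ} (hj : 1 ≤ j) (hjk : j < k) (hk : k ≤ n) :
    Commute (𝕃 k) (𝕃 j) :=
  commute_of_mem_parabolic (fun _ hi => Lm_commute_Tg_of_gt (by omega) hk)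
    (Lm_mem_parabolic hj le_rfl)

lemma Lm_commute_Lm {j k : ℕ} (hj1 : 1 ≤ j) (hj : j ≤ n) (hk1 : 1 ≤ k) (hk : k ≤ n) :
    Commute (𝕃 j) (𝕃 k) := by
  rcases lt_trichotomy j k with h | rfl | h
  · exact (Lm_commute_Lm_of_lt hj1 h hk).symm
  · exact Commute.refl _
  · exact Lm_commute_Lm_of_lt hk1 h hj

lemma Tg_mul_Lm_succ (hq : q ≠ 0) {k : ℕ} (h1 : 1 ≤ k) (hk : k < n) :
    𝕋 k * 𝕃 (k + 1) = (q - 1) • 𝕃 (k + 1) + 𝕃 k * 𝕋 k := by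
  have h : 𝕋 k * (𝕋 k * 𝕃 k * 𝕋 k) = (q - 1) • (𝕋 k * 𝕃 k * 𝕋 k) + q • (𝕃 k * 𝕋 k) := by
    rw [← mul_assoc, ← mul_assoc, Tg_sq h1 hk]
    simp only [add_mul, smul_mul_assoc, one_mul]
  rw [Lm_succ h1, mul_smul_comm, h, smul_add, smul_smul q⁻¹ q, inv_mul_cancel₀ hq, one_smul,
    smul_comm]

lemma Lm_succ_mul_Tg (hq : q ≠ 0) {k : ℕ} (h1 : 1 ≤ k) (hk : k < n) :
    𝕃 (k + 1) * 𝕋 k = (q - 1) • 𝕃 (k + 1) + 𝕋 k * 𝕃 k := by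
  have h : (𝕋 k * 𝕃 k * 𝕋 k) * 𝕋 k = (q - 1) • (𝕋 k * 𝕃 k * 𝕋 k) + q • (𝕋 k * 𝕃 k) := by
    rw [mul_assoc, Tg_sq h1 hk]
    simp only [mul_add, mul_smul_comm, mul_one]
  rw [Lm_succ h1, smul_mul_assoc, h, smul_add, smul_smul q⁻¹ q, inv_mul_cancel₀ hq, one_smul,
    smul_comm]

lemma Tg_commute_Lm_add (hq : q ≠ 0) {k : ℕ} (h1 : 1 ≤ k) (hk : k < n) :
    Commute (𝕋 k) (𝕃 k + 𝕃 (k + 1)) := by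
  rw [commute_iff_eq, mul_add, add_mul, Tg_mul_Lm_succ hq h1 hk, Lm_succ_mul_Tg hq h1 hk]
  abel

lemma Tg_commute_Lm_mul (hq : q ≠ 0) {k : ℕ} (h1 : 1 ≤ k) (hk : k < n) :
    Commute (𝕋 k) (𝕃 k * 𝕃 (k + 1)) := by
  have h : 𝕃 k * 𝕃 (k + 1) = 𝕃 (k + 1) * 𝕃 k :=
    Lm_commute_Lm h1 hk.le (by omega) hk
  rw [commute_iff_eq]
  nth_rewrite 1 [h]
  rw [Lm_succ h1] at h ⊢
  simp only [mul_smul_comm, smul_mul_assoc] at h ⊢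
  congr 1
  have hcomm : 𝕃 k * (𝕋 k * 𝕃 k * 𝕋 k) = 𝕋 k * 𝕃 k * 𝕋 k * 𝕃 k :=
    smul_right_injective _ (inv_ne_zero hq) h
  calc 𝕋 k * (𝕋 k * 𝕃 k * 𝕋 k * 𝕃 k) = 𝕋 k * (𝕃 k * (𝕋 k * 𝕃 k * 𝕋 k)) := by rw [hcomm]
    _ = (𝕋 k * 𝕃 k * 𝕋 k * 𝕃 k) * 𝕋 k := by simp only [mul_assoc]
    _ = _ := by rw [← hcomm]

/-- If `T` commutes with the elementary symmetric functions in two commuting elements `x`, `y`,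
then it commutes with their power sums. -/
lemma commute_pow_add_pow {A : Type} [Ring A] {T x y : A} (hxy : Commute x y)
    (hs : Commute T (x + y)) (hm : Commute T (x * y)) (m : ℕ) :
    Commute T (x ^ m + y ^ m) := by
  induction m using Nat.twoStepInduction with
  | zero => simp
  | one => simpa using hs
  | more m h0 h1 =>
    have e : x ^ (m + 2) + y ^ (m + 2) =
        (x + y) * (x ^ (m + 1) + y ^ (m + 1)) - (x * y) * (x ^ m + y ^ m) := by
      have h1 : y * x ^ (m + 1) = x ^ (m + 1) * y := ((hxy.pow_left _).eq).symm
      have h2 : x * y * x ^ m = x ^ (m + 1) * y := by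
        rw [mul_assoc, ← (hxy.pow_left m).eq, ← mul_assoc, ← pow_succ']
      have h3 : x * y * y ^ m = x * y ^ (m + 1) := by rw [mul_assoc, ← pow_succ']
      simp only [add_mul, mul_add, h1, h2, h3, ← pow_succ']
      abel
    rw [e]
    exact (hs.mul_right h1).sub_right (hm.mul_right h0)

lemma Tg_commute_Lm_pow_sub_mul (hq : q ≠ 0) {k : ℕ} (h1 : 1 ≤ k) (hk : k < n) (m : ℕ) (c : K) :
    Commute (𝕋 k) ((𝕃 k ^ m - algebraMap K _ c) * (𝕃 (k + 1) ^ m - algebraMap K _ c)) := by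
  have hL : Commute (𝕃 k) (𝕃 (k + 1)) := Lm_commute_Lm h1 hk.le (by omega) hk
  have e : (𝕃 k ^ m - algebraMap K _ c) * (𝕃 (k + 1) ^ m - algebraMap K _ c) =
      (𝕃 k * 𝕃 (k + 1)) ^ m - c • (𝕃 k ^ m + 𝕃 (k + 1) ^ m) + algebraMap K _ (c * c) := by
    rw [hL.mul_pow, map_mul]
    simp only [Algebra.algebraMap_eq_smul_one, mul_sub, sub_mul, smul_mul_assoc, mul_smul_comm,
      one_mul, mul_one, smul_add, smul_sub]
    abel
  rw [e]
  exact ((((Tg_commute_Lm_mul hq h1 hk).pow_right m).sub_right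
    ((commute_pow_add_pow hL (Tg_commute_Lm_add hq h1 hk) (Tg_commute_Lm_mul hq h1 hk) m).smul_right
      c)).add_right (Algebra.commutes _ _).symm)

end relations

end HuMathas

namespace HuMathas

section grading

variable {K : Type} [Field K] {q : K} {p : ℕ} {t : ℕ} {Q : Fin t → K} {n : ℕ}

local notation "𝕋" => Tg K q p Q n
local notation "𝕃" => Lm K q p Q n
local notation "𝔸" => AKp K q p Q n

/-- A product of linear factors with nonzero roots has nonzero constant term. -/
lemma exists_prod_sub_eq {A ι : Type} [Ring A] [Algebra K A] (x : A) (a : ι → K)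
    (ha : ∀ i, a i ≠ 0) (l : List ι) :
    ∃ y ∈ Algebra.adjoin K {x}, ∃ s : K, s ≠ 0 ∧
      (l.map fun i => x - algebraMap K A (a i)).prod = x * y + algebraMap K A s := by
  induction l with
  | nil => exact ⟨0, zero_mem _, 1, one_ne_zero, by simp⟩
  | cons i l ih =>
    obtain ⟨y, hy, s, hs, e⟩ := ih
    refine ⟨(x - algebraMap K A (a i)) * y + algebraMap K A s, ?_, -(a i * s),
      neg_ne_zero.mpr (mul_ne_zero (ha i) hs), ?_⟩
    · have hx : x ∈ Algebra.adjoin K {x} := Algebra.self_mem_adjoin_singleton K x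
      exact add_mem (mul_mem (sub_mem hx (Subalgebra.algebraMap_mem _ _)) hy)
        (Subalgebra.algebraMap_mem _ _)
    · rw [List.map_cons, List.prod_cons, e]
      simp only [Algebra.algebraMap_eq_smul_one, sub_mul, mul_add, mul_sub, smul_mul_assoc,
        mul_smul_comm, one_mul, mul_one, neg_smul, mul_smul, smul_sub, smul_comm s (a i)]
      abel

lemma Tg_mem_AKp {i : ℕ} (hi : 1 ≤ i) : 𝕋 i ∈ 𝔸 := by
  rcases lt_or_ge i n with hn | hn
  · exact Algebra.subset_adjoin (Or.inr ⟨i, hi, hn, rfl⟩)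
  · rw [Tg_of_le hn]
    exact one_mem _

lemma Tg_zero_pow_mem_AKp : 𝕋 0 ^ p ∈ 𝔸 :=
  Algebra.subset_adjoin (Or.inl (Or.inl rfl))

lemma exists_Tg_zero_pow_mul_eq_one (hn : 0 < n) (hQ : ∀ i, Q i ≠ 0) :
    ∃ z ∈ 𝔸, 𝕋 0 ^ p * z = 1 ∧ z * 𝕋 0 ^ p = 1 := by
  obtain ⟨y, hy, s, hs, e⟩ := exists_prod_sub_eq (𝕋 0 ^ p) (fun k => Q k ^ p)
    (fun k => pow_ne_zero _ (hQ k)) (List.finRange t)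
  rw [Tg_cyclo hn] at e
  have hle : Algebra.adjoin K {𝕋 0 ^ p} ≤ 𝔸 :=
    Algebra.adjoin_le (by rintro _ rfl; exact Tg_zero_pow_mem_AKp)
  have e' : 𝕋 0 ^ p * y = -s • 1 := by
    rw [neg_smul, ← Algebra.algebraMap_eq_smul_one]
    exact eq_neg_of_add_eq_zero_left e.symm
  have hc : y * 𝕋 0 ^ p = 𝕋 0 ^ p * y :=
    ((commute_of_mem_adjoin (by rintro _ rfl; exact Commute.refl _) hy).eq).symm
  refine ⟨(-s⁻¹) • y, Subalgebra.smul_mem _ (hle hy) _, ?_, ?_⟩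
  · rw [mul_smul_comm, e', smul_smul, neg_mul_neg, inv_mul_cancel₀ hs, one_smul]
  · rw [smul_mul_assoc, hc, e', smul_smul, neg_mul_neg, inv_mul_cancel₀ hs, one_smul]

lemma isUnit_Tg_zero (hp : 0 < p) (hn : 0 < n) (hQ : ∀ i, Q i ≠ 0) : IsUnit (𝕋 0) := by
  obtain ⟨z, -, h1, h2⟩ := exists_Tg_zero_pow_mul_eq_one (q := q) (p := p) hn hQ
  exact (isUnit_pow_iff hp.ne').mp ⟨⟨_, z, h1, h2⟩, rfl⟩

lemma isUnit_Lm (hq : q ≠ 0) (hp : 0 < p) (hn : 0 < n) (hQ : ∀ i, Q i ≠ 0) {k : ℕ} (hk : 1 ≤ k) :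
    IsUnit (𝕃 k) := by
  induction k, hk using Nat.le_induction with
  | base => exact isUnit_Tg_zero hp hn hQ
  | succ k hk ih =>
    rw [Lm_succ hk]
    exact (((Tg_isUnit hq hk).mul ih).mul (Tg_isUnit hq hk)).smul (Units.mk0 _ (inv_ne_zero hq))

/-- Conjugation by `T_0` preserves `H_{r,p,n}`. -/
lemma exists_Tg_zero_mul_eq (hq : q ≠ 0) (hp : 0 < p) (hn : 1 < n) (hQ : ∀ i, Q i ≠ 0)
    {x : AK K q p Q n} (hx : x ∈ 𝔸) : ∃ y ∈ 𝔸, 𝕋 0 * x = y * 𝕋 0 := by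
  obtain ⟨u, hu⟩ := isUnit_Tg_zero (q := q) hp (zero_lt_one.trans hn) hQ
  have huinv : Ring.inverse (𝕋 0) = ↑u⁻¹ := by rw [← hu, Ring.inverse_unit]
  induction hx using Algebra.adjoin_induction with
  | mem x hx =>
    rcases hx with (rfl | rfl) | ⟨i, hi, hin, rfl⟩
    · exact ⟨_, Tg_zero_pow_mem_AKp, (Commute.refl _).pow_right _⟩
    · refine ⟨𝕋 1, Tg_mem_AKp le_rfl, ?_⟩
      rw [huinv, ← hu, mul_assoc, Units.mul_inv_cancel_left]
    · rcases hi.eq_or_lt with rfl | hi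
      · obtain ⟨w, hw⟩ := Tg_isUnit (p := p) (Q := Q) (n := n) hq (le_refl 1)
        have hS : (↑u⁻¹ * 𝕋 1 * 𝕋 0 : AK K q p Q n) ∈ 𝔸 :=
          Algebra.subset_adjoin (Or.inl (Or.inr (by rw [huinv]; rfl)))
        have hwm : (↑w⁻¹ : AK K q p Q n) ∈ 𝔸 := by
          have e : (↑w⁻¹ : AK K q p Q n) = q⁻¹ • (𝕋 1 - (q - 1) • 1) := by
            refine Units.inv_eq_of_mul_eq_one_right ?_
            rw [hw, mul_smul_comm, mul_sub, Tg_sq le_rfl hn, mul_smul_comm, mul_one,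
              add_sub_cancel_left, smul_smul, inv_mul_cancel₀ hq, one_smul]
          rw [e]
          exact Subalgebra.smul_mem _ (sub_mem (Tg_mem_AKp le_rfl)
            (Subalgebra.smul_mem _ (one_mem _) _)) _
        refine ⟨_, mul_mem (mul_mem hwm hS) (Tg_mem_AKp le_rfl), ?_⟩
        have hb := Tg_braid_zero (K := K) (q := q) (p := p) (Q := Q) hn
        calc 𝕋 0 * 𝕋 1 = ↑w⁻¹ * (↑u⁻¹ * (𝕋 0 * (𝕋 1 * 𝕋 0 * 𝕋 1))) := by
              rw [← hu, Units.inv_mul_cancel_left, ← hw, mul_assoc, Units.inv_mul_cancel_left]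
          _ = ↑w⁻¹ * (↑u⁻¹ * (𝕋 0 * 𝕋 1 * 𝕋 0 * 𝕋 1)) := by simp only [mul_assoc]
          _ = _ := by rw [hb]; simp only [mul_assoc]
      · exact ⟨_, Tg_mem_AKp (by omega), Tg_commute_of_lt (by omega)⟩
  | algebraMap r => exact ⟨_, Subalgebra.algebraMap_mem _ r, (Algebra.commutes _ _).symm⟩
  | add a b _ _ ha hb =>
    obtain ⟨y, hy, e⟩ := ha
    obtain ⟨y', hy', e'⟩ := hb
    exact ⟨y + y', add_mem hy hy', by rw [mul_add, add_mul, e, e']⟩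
  | mul a b _ _ ha hb =>
    obtain ⟨y, hy, e⟩ := ha
    obtain ⟨y', hy', e'⟩ := hb
    exact ⟨y * y', mul_mem hy hy', by rw [← mul_assoc, e, mul_assoc, e', mul_assoc]⟩

/-- `H_{r,n}` is spanned as a left `H_{r,p,n}`-module by the powers of `T_0`. -/
lemma mem_span_AKp_mul_Tg_zero_pow (hq : q ≠ 0) (hp : 0 < p) (hn : 1 < n) (hQ : ∀ i, Q i ≠ 0)
    (h : AK K q p Q n) :
    h ∈ Submodule.span K {y | ∃ x ∈ 𝔸, ∃ i : ℕ, y = x * 𝕋 0 ^ i} := by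
  set S := Submodule.span K {y | ∃ x ∈ 𝔸, ∃ i : ℕ, y = x * 𝕋 0 ^ i}
  have key : ∀ s ∈ S, h * s ∈ S := by
    have hh : h ∈ parabolic K q p Q n n := by rw [parabolic_self]; trivial
    induction hh using Algebra.adjoin_induction with
    | mem z hz =>
      obtain ⟨j, -, rfl⟩ := hz
      intro s hs
      induction hs using Submodule.span_induction with
      | mem s hs =>
        obtain ⟨x, hx, i, rfl⟩ := hs
        rcases Nat.eq_zero_or_pos j with rfl | hj
        · obtain ⟨y, hy, e⟩ := exists_Tg_zero_mul_eq hq hp hn hQ hx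
          exact Submodule.subset_span ⟨y, hy, i + 1, by rw [← mul_assoc, e, mul_assoc, pow_succ']⟩
        · exact Submodule.subset_span ⟨𝕋 j * x, mul_mem (Tg_mem_AKp hj) hx, i,
            (mul_assoc _ _ _).symm⟩
      | zero => rw [mul_zero]; exact zero_mem _
      | add a b _ _ ha hb => rw [mul_add]; exact add_mem ha hb
      | smul r a _ ha => rw [mul_smul_comm]; exact S.smul_mem r ha
    | algebraMap r =>
      intro s hs
      rw [← Algebra.smul_def]
      exact S.smul_mem r hs
    | add a b _ _ ha hb => intro s hs; rw [add_mul]; exact add_mem (ha s hs) (hb s hs)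
    | mul a b _ _ ha hb => intro s hs; rw [mul_assoc]; exact ha _ (hb s hs)
  simpa using key 1 (Submodule.subset_span ⟨1, one_mem _, 0, by simp⟩)

lemma exists_eq_sum_mul_Tg_zero_pow (hq : q ≠ 0) (hp : 0 < p) (hn : 1 < n) (hQ : ∀ i, Q i ≠ 0)
    (h : AK K q p Q n) :
    ∃ c : ℕ → AK K q p Q n, (∀ i, c i ∈ 𝔸) ∧ h = ∑ i ∈ Finset.range p, c i * 𝕋 0 ^ i := by
  induction mem_span_AKp_mul_Tg_zero_pow hq hp hn hQ h using Submodule.span_induction with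
  | mem s hs =>
    obtain ⟨x, hx, i, rfl⟩ := hs
    refine ⟨Pi.single (i % p) (x * (𝕋 0 ^ p) ^ (i / p)), fun j => ?_, ?_⟩
    · by_cases hj : j = i % p
      · rw [hj, Pi.single_eq_same]
        exact mul_mem hx (pow_mem Tg_zero_pow_mem_AKp _)
      · rw [Pi.single_eq_of_ne hj]
        exact zero_mem _
    · rw [Finset.sum_eq_single (i % p)]
      · rw [Pi.single_eq_same, mul_assoc, ← pow_mul, ← pow_add, Nat.div_add_mod]
      · intro j _ hj
        rw [Pi.single_eq_of_ne hj, zero_mul]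
      · intro hi
        exact absurd (Finset.mem_range.mpr (Nat.mod_lt _ hp)) hi
  | zero => exact ⟨0, fun _ => zero_mem _, by simp⟩
  | add a b _ _ ha hb =>
    obtain ⟨c, hc, rfl⟩ := ha
    obtain ⟨d, hd, rfl⟩ := hb
    exact ⟨c + d, fun i => add_mem (hc i) (hd i), by
      simp only [Pi.add_apply, add_mul, Finset.sum_add_distrib]⟩
  | smul r a _ ha =>
    obtain ⟨c, hc, rfl⟩ := ha
    exact ⟨r • c, fun i => Subalgebra.smul_mem _ (hc i) _, by
      simp only [Pi.smul_apply, smul_mul_assoc, Finset.smul_sum]⟩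

lemma exists_twist {ε : K} (hε : ε ^ p = 1) (hn : 0 < n) :
    ∃ f : AK K q p Q n →ₐ[K] AK K q p Q n, f (𝕋 0) = ε • 𝕋 0 ∧ ∀ i, 1 ≤ i → f (𝕋 i) = 𝕋 i := by
  let g : FreeAlgebra K (Fin n) →ₐ[K] AK K q p Q n :=
    FreeAlgebra.lift K fun i : Fin n => (if i.1 = 0 then ε else 1) • 𝕋 i.1
  have hg0 : ∀ h : 0 < n, g (FreeAlgebra.ι K ⟨0, h⟩) = ε • 𝕋 0 := fun h => by simp [g]
  have hg : ∀ i, ∀ h : i < n, 1 ≤ i → g (FreeAlgebra.ι K ⟨i, h⟩) = 𝕋 i := fun i h h1 => by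
    simp [g, Nat.one_le_iff_ne_zero.mp h1]
  have w : ∀ ⦃x y⦄, AKRel K q p Q n x y → g x = g y := by
    intro x y h
    cases h with
    | cyclo h0 =>
      simpa only [map_list_prod, List.map_map, Function.comp_def, map_sub, map_pow, hg0,
        AlgHom.commutes, map_zero, smul_pow, hε, one_smul] using
          Tg_cyclo (q := q) (p := p) (Q := Q) h0
    | braid01 h1 =>
      simp only [map_mul, hg0, hg 1 h1 le_rfl, smul_mul_assoc, mul_smul_comm,
        Tg_braid_zero h1]
    | quad i hi hin =>
      simpa only [map_mul, map_add, map_sub, map_one, map_zero, hg i hin hi, AlgHom.commutes,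
        AK.mk_ι] using AK.mk_rel (AKRel.quad (q := q) (p := p) (Q := Q) i hi hin)
    | braid i hi hin =>
      simpa only [map_mul, hg i (by omega) hi, hg (i + 1) hin (by omega)] using Tg_braid hi hin
    | comm i j hij hj =>
      have hc : 𝕋 i * 𝕋 j = 𝕋 j * 𝕋 i := Tg_commute_of_lt hij
      rcases Nat.eq_zero_or_pos i with rfl | hi
      · simp only [map_mul, hg0, hg j hj (by omega), smul_mul_assoc, mul_smul_comm, hc]
      · simp only [map_mul, hg i (by omega) hi, hg j hj (by omega), hc]
  let f : AK K q p Q n →ₐ[K] AK K q p Q n := RingQuot.liftAlgHom K ⟨g, w⟩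
  have hf : ∀ x, f (AK.mk x) = g x := RingQuot.liftAlgHom_mkAlgHom_apply K g w
  refine ⟨f, ?_, fun i hi => ?_⟩
  · rw [← AK.mk_ι 0 hn, hf, hg0, AK.mk_ι]
  · rcases lt_or_ge i n with h | h
    · rw [← AK.mk_ι i h, hf, hg i h hi, AK.mk_ι]
    · rw [Tg_of_le h, map_one]

/-- The endomorphism of `H_{r,n}` sending `T_0` to `ε T_0` and fixing the other generators. -/
def twist {ε : K} (hε : ε ^ p = 1) (hn : 0 < n) : AK K q p Q n →ₐ[K] AK K q p Q n :=
  (exists_twist hε hn).choose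

variable {ε : K}

lemma twist_Tg_zero (hε : ε ^ p = 1) (hn : 0 < n) : twist hε hn (𝕋 0) = ε • 𝕋 0 :=
  (exists_twist hε hn).choose_spec.1

lemma twist_Tg (hε : ε ^ p = 1) (hn : 0 < n) {i : ℕ} (hi : 1 ≤ i) : twist hε hn (𝕋 i) = 𝕋 i :=
  (exists_twist hε hn).choose_spec.2 i hi

lemma twist_Lm (hε : ε ^ p = 1) (hn : 0 < n) {k : ℕ} (hk : 1 ≤ k) :
    twist hε hn (𝕃 k) = ε • 𝕃 k := by
  induction k, hk using Nat.le_induction with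
  | base => exact twist_Tg_zero hε hn
  | succ k hk ih =>
    rw [Lm_succ hk, map_smul, map_mul, map_mul, ih, twist_Tg hε hn hk, mul_smul_comm,
      smul_mul_assoc, smul_comm]

lemma twist_of_mem_AKp (hε : ε ^ p = 1) (hp : 0 < p) (hn : 0 < n) (hQ : ∀ i, Q i ≠ 0)
    {x : AK K q p Q n} (hx : x ∈ 𝔸) : twist hε hn x = x := by
  induction hx using Algebra.adjoin_induction with
  | mem x hx =>
    rcases hx with (rfl | rfl) | ⟨i, hi, hin, rfl⟩
    · rw [map_pow, twist_Tg_zero, smul_pow, hε, one_smul]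
    · obtain ⟨u, hu⟩ := isUnit_Tg_zero (q := q) hp hn hQ
      have h1 : (twist hε hn (↑u⁻¹ : AK K q p Q n)) * (ε • ↑u) = 1 := by
        rw [hu, ← twist_Tg_zero hε hn, ← map_mul, ← hu, Units.inv_mul, map_one]
      have h2 : ε • twist hε hn (↑u⁻¹ : AK K q p Q n) = ↑u⁻¹ := by
        rw [mul_smul_comm, ← smul_mul_assoc] at h1
        exact (Units.eq_inv_of_mul_eq_one_right h1)
      rw [← hu, Ring.inverse_unit, map_mul, map_mul, hu, twist_Tg_zero, twist_Tg hε hn le_rfl,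
        mul_smul_comm, ← smul_mul_assoc, ← smul_mul_assoc, h2]
    · exact twist_Tg hε hn hi
  | algebraMap r => exact AlgHom.commutes _ _
  | add a b _ _ ha hb => rw [map_add, ha, hb]
  | mul a b _ _ ha hb => rw [map_mul, ha, hb]

/-- Eigenvectors for distinct powers of a primitive root of unity are independent. -/
lemma eq_zero_of_sum_eigenvectors {V : Type} [AddCommGroup V] [Module K V] (f : V →ₗ[K] V)
    (hε : IsPrimitiveRoot ε p) {x : Fin p → V} (hx : ∀ i : Fin p, f (x i) = ε ^ i.1 • x i)
    (h : ∑ i, x i = 0) (i : Fin p) : x i = 0 := by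
  have hinj : Function.Injective fun i : Fin p => ε ^ i.1 := fun i j hij =>
    Fin.ext (hε.pow_inj i.2 j.2 hij)
  have hind := (Module.End.eigenspaces_iSupIndep f).comp hinj
  refine Submodule.disjoint_def.mp (hind i) _ (Module.End.mem_eigenspace_iff.mpr (hx i)) ?_
  rw [← Finset.add_sum_erase _ _ (Finset.mem_univ i)] at h
  rw [eq_neg_of_add_eq_zero_left h]
  refine neg_mem (sum_mem fun j hj => ?_)
  exact Submodule.mem_iSup_of_mem j (Submodule.mem_iSup_of_mem (Finset.ne_of_mem_erase hj)
    (Module.End.mem_eigenspace_iff.mpr (hx j)))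

lemma exists_eq_sum_fin_mul_Tg_zero_pow (hq : q ≠ 0) (hp : 0 < p) (hn : 1 < n)
    (hQ : ∀ i, Q i ≠ 0) (h : AK K q p Q n) :
    ∃ c : Fin p → 𝔸, h = ∑ i, (c i : AK K q p Q n) * 𝕋 0 ^ i.1 := by
  obtain ⟨c, hc, e⟩ := exists_eq_sum_mul_Tg_zero_pow hq hp hn hQ h
  exact ⟨fun i => ⟨c i, hc i⟩, by rw [e, Finset.sum_range]⟩

lemma twist_mul_Tg_zero_pow (hε : ε ^ p = 1) (hp : 0 < p) (hn : 0 < n) (hQ : ∀ i, Q i ≠ 0)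
    (c : 𝔸) (i : ℕ) :
    twist hε hn ((c : AK K q p Q n) * 𝕋 0 ^ i) = ε ^ i • ((c : AK K q p Q n) * 𝕋 0 ^ i) := by
  rw [map_mul, twist_of_mem_AKp hε hp hn hQ c.2, map_pow, twist_Tg_zero, smul_pow, mul_smul_comm]

lemma mem_AKp_of_twist_eq (hε : IsPrimitiveRoot ε p) (hq : q ≠ 0) (hp : 0 < p) (hn : 1 < n)
    (hQ : ∀ i, Q i ≠ 0) {x : AK K q p Q n}
    (hx : twist hε.pow_eq_one (zero_lt_one.trans hn) x = x) : x ∈ 𝔸 := by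
  obtain ⟨c, e⟩ := exists_eq_sum_fin_mul_Tg_zero_pow hq hp hn hQ x
  have h0 := eq_zero_of_sum_eigenvectors (twist hε.pow_eq_one (zero_lt_one.trans hn)).toLinearMap hε
    (x := fun i => (c i : AK K q p Q n) * 𝕋 0 ^ i.1 - if i = ⟨0, hp⟩ then x else 0)
    (fun i => ?_) ?_ ⟨0, hp⟩
  · simp only [pow_zero, mul_one, if_true] at h0
    rw [← sub_eq_zero.mp h0]
    exact (c _).2
  · simp only [AlgHom.toLinearMap_apply, map_sub, smul_sub,
      twist_mul_Tg_zero_pow hε.pow_eq_one hp (zero_lt_one.trans hn) hQ]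
    split_ifs with hi
    · rw [hx, hi, pow_zero, one_smul, one_smul]
    · rw [map_zero, smul_zero]
  · rw [Finset.sum_sub_distrib, ← e, Finset.sum_ite_eq', if_pos (Finset.mem_univ _), sub_self]

end grading

end HuMathas

namespace HuMathas

section intertwining

variable {K : Type} [Field K] {q : K} {p : ℕ} {t : ℕ} {Q : Fin t → K} {n : ℕ}

local notation "𝕋" => Tg K q p Q n
local notation "𝕃" => Lm K q p Q n
local notation "ℍ" => parabolic K q p Q n

/-- The commutative subalgebra generated by the Murphy elements. -/
def murphyAlg (K : Type) [Field K] (q : K) (p : ℕ) {t : ℕ} (Q : Fin t → K) (n : ℕ) :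
    Subalgebra K (AK K q p Q n) :=
  Algebra.adjoin K {x | ∃ j, 1 ≤ j ∧ j ≤ n ∧ x = Lm K q p Q n j}

local notation "𝓛" => murphyAlg K q p Q n

lemma Lm_mem_murphyAlg {j : ℕ} (h1 : 1 ≤ j) (hj : j ≤ n) : 𝕃 j ∈ 𝓛 :=
  Algebra.subset_adjoin ⟨j, h1, hj, rfl⟩

lemma commute_of_mem_murphyAlg {x y : AK K q p Q n} (hx : x ∈ 𝓛) (hy : y ∈ 𝓛) : Commute x y := by
  refine commute_of_mem_adjoin ?_ hy
  rintro _ ⟨j, h1, hj, rfl⟩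
  refine (commute_of_mem_adjoin ?_ hx).symm
  rintro _ ⟨k, hk1, hk, rfl⟩
  exact Lm_commute_Lm h1 hj hk1 hk

/-- The product `(L_1^p - Q_{k+1}^p) ⋯ (L_m^p - Q_{k+1}^p)`. -/
def uFactor (K : Type) [Field K] (q : K) (p : ℕ) {t : ℕ} (Q : Fin t → K) (n k m : ℕ) :
    AK K q p Q n :=
  ((List.range m).map (fun m0 =>
    Lm K q p Q n (m0 + 1) ^ p - algebraMap K _ (Qat K Q (k + 1) ^ p))).prod

/-- The product over `s < k ≤ s + l` of `(L_1^p - Q_k^p) ⋯ (L_m^p - Q_k^p)`. -/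
def uProd (K : Type) [Field K] (q : K) (p : ℕ) {t : ℕ} (Q : Fin t → K) (n s l m : ℕ) :
    AK K q p Q n :=
  ((List.range l).map (fun k0 => uFactor K q p Q n (s + k0) m)).prod

local notation "ψ" => uFactor K q p Q n
local notation "𝕌" => uProd K q p Q n

lemma uFactor_zero (k : ℕ) : ψ k 0 = 1 := rfl

lemma uFactor_succ (k m : ℕ) :
    ψ k (m + 1) = ψ k m * (𝕃 (m + 1) ^ p - algebraMap K _ (Qat K Q (k + 1) ^ p)) := by
  simp [uFactor, List.range_succ]

lemma uProd_succ (s l m : ℕ) : 𝕌 s (l + 1) m = 𝕌 s l m * ψ (s + l) m := by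
  simp [uProd, List.range_succ]

lemma uProd_zero (s m : ℕ) : 𝕌 s 0 m = 1 := rfl

lemma uProd_zero_right (s l : ℕ) : 𝕌 s l 0 = 1 := by
  induction l with
  | zero => rfl
  | succ l ih => rw [uProd_succ, ih, uFactor_zero, mul_one]

lemma uProd_mul (s l l' m : ℕ) : 𝕌 s l m * 𝕌 (s + l) l' m = 𝕌 s (l + l') m := by
  induction l' with
  | zero => rw [uProd_zero, mul_one, add_zero]
  | succ l' ih => rw [uProd_succ, ← mul_assoc, ih, ← add_assoc, uProd_succ, add_assoc]

lemma Lm_factor_mem_murphyAlg (k : ℕ) {j : ℕ} (h1 : 1 ≤ j) (hj : j ≤ n) :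
    𝕃 j ^ p - algebraMap K _ (Qat K Q (k + 1) ^ p) ∈ 𝓛 :=
  sub_mem (pow_mem (Lm_mem_murphyAlg h1 hj) _) (Subalgebra.algebraMap_mem _ _)

lemma uFactor_mem_murphyAlg (k : ℕ) {m : ℕ} (hm : m ≤ n) : ψ k m ∈ 𝓛 := by
  induction m with
  | zero => exact one_mem _
  | succ m ih =>
    rw [uFactor_succ]
    exact mul_mem (ih (by omega)) (Lm_factor_mem_murphyAlg k (by omega) hm)

lemma uProd_mem_murphyAlg (s l : ℕ) {m : ℕ} (hm : m ≤ n) : 𝕌 s l m ∈ 𝓛 := by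
  induction l with
  | zero => exact one_mem _
  | succ l ih =>
    rw [uProd_succ]
    exact mul_mem ih (uFactor_mem_murphyAlg _ hm)

lemma uProd_mem_parabolic (s l : ℕ) {m m' : ℕ} (hm : m ≤ m') : 𝕌 s l m ∈ ℍ m' := by
  refine Subalgebra.list_prod_mem _ fun x hx => ?_
  obtain ⟨k, -, rfl⟩ := List.mem_map.mp hx
  refine Subalgebra.list_prod_mem _ fun x hx => ?_
  obtain ⟨j, hj, rfl⟩ := List.mem_map.mp hx
  have hj := List.mem_range.mp hj
  exact sub_mem (pow_mem (Lm_mem_parabolic (by omega) (by omega)) _) (Subalgebra.algebraMap_mem _ _)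

lemma Tg_commute_uFactor (hq : q ≠ 0) (k : ℕ) {i m : ℕ} (hm : m ≤ n) (hi : i < n) (him : i ≠ m) :
    Commute (𝕋 i) (ψ k m) := by
  have hL : ∀ j, 1 ≤ j → j ≤ n → i ≠ j → i + 1 ≠ j →
      Commute (𝕋 i) (𝕃 j ^ p - algebraMap K _ (Qat K Q (k + 1) ^ p)) := by
    intro j h1 hj hij hij'
    refine Commute.sub_right (Commute.pow_right ?_ _) (Algebra.commutes _ _).symm
    rcases lt_or_gt_of_ne hij with h | h
    · exact (Lm_commute_Tg_of_gt (by omega) hj).symm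
    · exact (Lm_commute_Tg_of_lt h1 h).symm
  induction m using Nat.twoStepInduction with
  | zero => exact Commute.one_right _
  | one =>
    rw [uFactor_succ, uFactor_zero, one_mul]
    rcases Nat.eq_zero_or_pos i with rfl | h
    · exact ((Commute.refl _).pow_right _).sub_right (Algebra.commutes _ _).symm
    · exact hL 1 le_rfl hm him (by omega)
  | more m ih0 ih1 =>
    rw [uFactor_succ]
    by_cases h : i = m + 1
    · rw [uFactor_succ, mul_assoc]
      subst h
      exact (ih0 (by omega) (by omega)).mul_right (Tg_commute_Lm_pow_sub_mul hq (by omega) hi _ _)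
    · exact (ih1 (by omega) h).mul_right (hL _ (by omega) hm him (by omega))

lemma Tg_commute_uProd (hq : q ≠ 0) (s l : ℕ) {i m : ℕ} (hm : m ≤ n) (hi : i < n) (him : i ≠ m) :
    Commute (𝕋 i) (𝕌 s l m) := by
  induction l with
  | zero => exact Commute.one_right _
  | succ l ih =>
    rw [uProd_succ]
    exact ih.mul_right (Tg_commute_uFactor hq _ hm hi him)

lemma exists_uFactor_eq (k : ℕ) {m : ℕ} (h1 : 1 ≤ m) (hm : m ≤ n) :
    ∃ R ∈ 𝓛, ψ k m = R * ψ k 1 := by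
  induction m, h1 using Nat.le_induction with
  | base => exact ⟨1, one_mem _, (one_mul _).symm⟩
  | succ m h1 ih =>
    obtain ⟨R, hR, e⟩ := ih (by omega)
    have hL := Lm_factor_mem_murphyAlg (q := q) (p := p) (Q := Q) k (by omega : 1 ≤ m + 1) hm
    refine ⟨_, mul_mem hR hL, ?_⟩
    rw [uFactor_succ, e, mul_assoc, mul_assoc,
      (commute_of_mem_murphyAlg (uFactor_mem_murphyAlg k (by omega)) hL).eq]

lemma exists_uProd_eq (s l : ℕ) {m : ℕ} (h1 : 1 ≤ m) (hm : m ≤ n) :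
    ∃ R ∈ 𝓛, 𝕌 s l m = R * 𝕌 s l 1 := by
  induction l with
  | zero => exact ⟨1, one_mem _, (one_mul _).symm⟩
  | succ l ih =>
    obtain ⟨R, hR, e⟩ := ih
    obtain ⟨R', hR', e'⟩ := exists_uFactor_eq (q := q) (p := p) (Q := Q) (s + l) h1 hm
    refine ⟨_, mul_mem hR hR', ?_⟩
    rw [uProd_succ, uProd_succ, e, e', mul_assoc, mul_assoc, ← mul_assoc _ R',
      (commute_of_mem_murphyAlg (uProd_mem_murphyAlg _ _ (by omega)) hR').eq, mul_assoc]

lemma uProd_cyclo (hn : 0 < n) : 𝕌 0 t 1 = 0 := by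
  rw [← Tg_cyclo (q := q) (p := p) (Q := Q) hn, uProd, ← List.map_coe_finRange_eq_range,
    List.map_map]
  congr 2
  funext k
  have h : Qat K Q (k.1 + 1) = Q k := by
    have := k.2
    simp [Qat]
  simp [uFactor, h, Lm_one]

/-- The product `T_k T_{k-1} ⋯ T_1`. -/
def descProd (K : Type) [Field K] (q : K) (p : ℕ) {t : ℕ} (Q : Fin t → K) (n : ℕ) :
    ℕ → AK K q p Q n
  | 0 => 1
  | k + 1 => Tg K q p Q n (k + 1) * descProd K q p Q n k

/-- The product `T_{k+1} T_k ⋯ T_2`. -/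
def descProdTwo (K : Type) [Field K] (q : K) (p : ℕ) {t : ℕ} (Q : Fin t → K) (n : ℕ) :
    ℕ → AK K q p Q n
  | 0 => 1
  | k + 1 => Tg K q p Q n (k + 2) * descProdTwo K q p Q n k

/-- The product `T_1 T_2 ⋯ T_k`. -/
def ascProd (K : Type) [Field K] (q : K) (p : ℕ) {t : ℕ} (Q : Fin t → K) (n : ℕ) :
    ℕ → AK K q p Q n
  | 0 => 1
  | k + 1 => ascProd K q p Q n k * Tg K q p Q n (k + 1)

local notation "𝖣" => descProd K q p Q n
local notation "𝖤" => descProdTwo K q p Q n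
local notation "𝖯" => ascProd K q p Q n

lemma descProd_succ_eq (k : ℕ) : 𝖣 (k + 1) = 𝖤 k * 𝕋 1 := by
  induction k with
  | zero => simp [descProd, descProdTwo]
  | succ k ih => rw [descProd, ih, descProdTwo, mul_assoc]

lemma commute_descProd {x : AK K q p Q n} {k : ℕ} (h : ∀ i, 1 ≤ i → i ≤ k → Commute x (𝕋 i)) :
    Commute x (𝖣 k) := by
  induction k with
  | zero => exact Commute.one_right _
  | succ k ih =>
    exact (h _ (by omega) le_rfl).mul_right (ih fun i h1 hi => h i h1 (by omega))

lemma commute_descProdTwo {x : AK K q p Q n} {k : ℕ}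
    (h : ∀ i, 2 ≤ i → i ≤ k + 1 → Commute x (𝕋 i)) : Commute x (𝖤 k) := by
  induction k with
  | zero => exact Commute.one_right _
  | succ k ih =>
    exact (h _ (by omega) le_rfl).mul_right (ih fun i h1 hi => h i h1 (by omega))

lemma commute_ascProd {x : AK K q p Q n} {k : ℕ} (h : ∀ i, 1 ≤ i → i ≤ k → Commute x (𝕋 i)) :
    Commute x (𝖯 k) := by
  induction k with
  | zero => exact Commute.one_right _
  | succ k ih =>
    exact (ih fun i h1 hi => h i h1 (by omega)).mul_right (h _ (by omega) le_rfl)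

lemma descProd_mem_parabolic {k m : ℕ} (h : k + 1 ≤ m) : 𝖣 k ∈ ℍ m := by
  induction k with
  | zero => exact one_mem _
  | succ k ih => exact mul_mem (Tg_mem_parabolic (by omega)) (ih (by omega))

lemma isUnit_descProd (hq : q ≠ 0) (k : ℕ) : IsUnit (𝖣 k) := by
  induction k with
  | zero => exact isUnit_one
  | succ k ih => exact (Tg_isUnit hq (by omega)).mul ih

lemma Tg_mul_descProd {i k : ℕ} (h1 : 1 ≤ i) (hik : i < k) (hk : k < n) :
    𝕋 i * 𝖣 k = 𝖣 k * 𝕋 (i + 1) := by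
  induction k, hik using Nat.le_induction with
  | base =>
    obtain ⟨i, rfl⟩ := Nat.exists_eq_add_of_le' h1
    have hc : 𝕋 (i + 2) * 𝖣 i = 𝖣 i * 𝕋 (i + 2) :=
      commute_descProd fun j hj1 hj => (Tg_commute_of_lt (by omega)).symm
    have hb := Tg_braid (K := K) (q := q) (p := p) (Q := Q) h1 hk
    simp only [descProd, mul_assoc] at hb ⊢
    rw [← hc, ← mul_assoc, ← mul_assoc, ← mul_assoc, ← mul_assoc, mul_assoc _ (𝕋 (i + 1 + 1)), hb]
    simp only [mul_assoc]
  | succ k hik ih =>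
    have hc : 𝕋 i * 𝕋 (k + 1) = 𝕋 (k + 1) * 𝕋 i := Tg_commute_of_lt (by omega)
    rw [descProd, ← mul_assoc, hc, mul_assoc, ih (by omega), mul_assoc]

lemma ascProd_mul_descProd {c k : ℕ} (hc : c ≤ k) (hk : k + 1 < n) :
    𝖯 c * 𝖣 (k + 1) = 𝖤 k * 𝖯 (c + 1) := by
  induction c with
  | zero => simp [ascProd, descProd_succ_eq]
  | succ c ih =>
    rw [ascProd, mul_assoc, Tg_mul_descProd (by omega) (by omega) hk, ← mul_assoc,
      ih (by omega), mul_assoc]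
    rfl

lemma descProd_pow {c k : ℕ} (hc : c ≤ k + 1) (hk : k + 1 < n) :
    𝖣 (k + 1) ^ c = 𝖤 k ^ c * 𝖯 c := by
  induction c with
  | zero => simp [ascProd]
  | succ c ih =>
    rw [pow_succ, ih (by omega), mul_assoc, ascProd_mul_descProd (by omega) hk, ← mul_assoc,
      ← pow_succ]

lemma Tword_wabWord (a c : ℕ) : Tword K q p Q n (wabWord a c) = 𝖣 (a + c - 1) ^ c := by
  have h : ∀ k, ((List.range' 1 k).reverse.map 𝕋).prod = 𝖣 k := by
    intro k
    induction k with
    | zero => rfl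
    | succ k ih =>
      rw [List.range'_concat, List.reverse_append, List.map_append, List.prod_append, ih, descProd]
      simp [add_comm]
  simp only [Tword, wabWord, List.map_flatten, List.map_replicate, List.prod_flatten,
    List.prod_replicate, h]

/-- Moving `L_1` through `T_1 ⋯ T_c`, when the correction terms are annihilated. -/
lemma mul_Lm_one_mul_ascProd (hq : q ≠ 0) {f : AK K q p Q n}
    (hfT : ∀ i, 2 ≤ i → i < n → Commute f (𝕋 i))
    (hfL : ∀ j, 1 ≤ j → j ≤ n → Commute f (𝕃 j)) {c : ℕ} (hc : c < n) {G : AK K q p Q n}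
    (hG : ∀ i, 1 ≤ i → i < c → Commute G (𝕋 i)) (hfG : 0 < c → f * G = 0) :
    f * (𝕃 1 * (𝖯 c * G)) = f * (𝖯 c * (𝕃 (c + 1) * G)) := by
  induction c generalizing G with
  | zero => simp [ascProd]
  | succ c ih =>
    have hf0 := hfG (by omega)
    have key := ih (by omega) (G := 𝕋 (c + 1) * G)
      (fun i h1 hi => ((Tg_commute_of_lt (by omega)).symm).mul_left (hG i h1 (by omega)))
      (fun h => by rw [← mul_assoc, (hfT (c + 1) (by omega) hc).eq, mul_assoc, hf0, mul_zero])
    have e1 : 𝕃 (c + 1) * 𝕋 (c + 1) = 𝕋 (c + 1) * 𝕃 (c + 2) - (q - 1) • 𝕃 (c + 2) := by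
      rw [Tg_mul_Lm_succ hq (by omega) hc, add_sub_cancel_left]
    have e2 : f * (𝖯 c * (𝕃 (c + 2) * G)) = 0 := by
      have h1 : 𝕃 (c + 2) * 𝖯 c = 𝖯 c * 𝕃 (c + 2) :=
        commute_ascProd fun i h1 hi => Lm_commute_Tg_of_gt (by omega) (by omega)
      have h2 : G * 𝖯 c = 𝖯 c * G := commute_ascProd fun i h1 hi => hG i h1 (by omega)
      rw [← mul_assoc (𝖯 c), ← h1, mul_assoc, ← h2, ← mul_assoc, (hfL _ (by omega) hc).eq,
        mul_assoc, ← mul_assoc f, hf0, zero_mul, mul_zero]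
    rw [ascProd, mul_assoc, key, ← mul_assoc (𝕃 (c + 1)), e1, sub_mul, mul_sub, mul_sub,
      smul_mul_assoc, mul_smul_comm, mul_smul_comm, e2, smul_zero, sub_zero]
    simp only [mul_assoc]

lemma Lm_one_mul_mul_descProd (hq : q ≠ 0) {F' f : AK K q p Q n}
    (hfT : ∀ i, 2 ≤ i → i < n → Commute f (𝕋 i))
    (hfL : ∀ j, 1 ≤ j → j ≤ n → Commute f (𝕃 j)) (hF : Commute (F' * f) (𝕃 1))
    {c k : ℕ} (hck : c ≤ k) (hk : k < n) {G : AK K q p Q n}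
    (hG : ∀ i, 1 ≤ i → i < c → Commute G (𝕋 i)) (hfG : 0 < c → f * G = 0) :
    𝕃 1 * (F' * f * 𝖣 k ^ c * G) = F' * f * 𝖣 k ^ c * (𝕃 (c + 1) * G) := by
  rcases k with _ | k
  · obtain rfl : c = 0 := by omega
    simp only [pow_zero, mul_one, zero_add]
    rw [← mul_assoc, ← hF.eq, mul_assoc]
  have hE : f * 𝖤 k ^ c = 𝖤 k ^ c * f :=
    (commute_descProdTwo fun i h2 hi => hfT i h2 (by omega)).pow_right c
  have hL : 𝕃 1 * 𝖤 k ^ c = 𝖤 k ^ c * 𝕃 1 :=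
    (commute_descProdTwo fun i h2 hi => Lm_commute_Tg_of_lt le_rfl (by omega)).pow_right c
  have key := mul_Lm_one_mul_ascProd hq hfT hfL (by omega) hG hfG
  rw [descProd_pow hck hk]
  calc 𝕃 1 * (F' * f * (𝖤 k ^ c * 𝖯 c) * G) = (𝕃 1 * (F' * f)) * 𝖤 k ^ c * (𝖯 c * G) := by
        simp only [mul_assoc]
    _ = F' * f * (𝕃 1 * 𝖤 k ^ c) * (𝖯 c * G) := by rw [← hF.eq]; simp only [mul_assoc]
    _ = F' * (f * 𝖤 k ^ c) * (𝕃 1 * (𝖯 c * G)) := by rw [hL]; simp only [mul_assoc]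
    _ = F' * 𝖤 k ^ c * (f * (𝕃 1 * (𝖯 c * G))) := by rw [hE]; simp only [mul_assoc]
    _ = F' * (𝖤 k ^ c * f) * (𝖯 c * (𝕃 (c + 1) * G)) := by rw [key]; simp only [mul_assoc]
    _ = _ := by rw [← hE]; simp only [mul_assoc]

end intertwining

end HuMathas

namespace HuMathas

section intertwiner

variable {K : Type} [Field K] {q : K} {p : ℕ} {t : ℕ} {Q : Fin t → K} {n : ℕ}
variable {κ : ℕ} {t_ b : Fin κ → ℕ}

local notation "𝕋" => Tg K q p Q n
local notation "𝕃" => Lm K q p Q n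
local notation "ℍ" => parabolic K q p Q n
local notation "𝓛" => murphyAlg K q p Q n
local notation "𝕌" => uProd K q p Q n
local notation "𝖣" => descProd K q p Q n

lemma tsum_succ (α : ℕ) : tsum κ t_ (α + 1) = tsum κ t_ α + tat κ t_ (α + 1) := by
  rw [tsum, Finset.sum_Icc_succ_top (by omega), tsum]

lemma bsum_succ (α : ℕ) : bsum κ b (α + 1) = bsum κ b α + bat κ b (α + 1) := by
  rw [bsum, Finset.sum_Icc_succ_top (by omega), bsum]

lemma vplus_eq (a c s : ℕ) : vplus K q p Q n a c s = 𝕌 0 s a * 𝖣 (a + c - 1) ^ c := by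
  rw [vplus, Tword_wabWord]
  simp [uProd, uFactor]

/-- The element `v_b`, built up one part of the composition at a time. -/
def vbAux (K : Type) [Field K] (q : K) (p : ℕ) {t : ℕ} (Q : Fin t → K) (n κ : ℕ)
    (t_ b : Fin κ → ℕ) : ℕ → AK K q p Q n
  | 0 => 1
  | A + 1 => vplus K q p Q n (bat κ b (A + 2)) (bsum κ b (A + 1)) (tsum κ t_ (A + 1)) *
      vbAux K q p Q n κ t_ b A * uProd K q p Q n (tsum κ t_ (A + 1)) (tat κ t_ (A + 2))
        (bsum κ b (A + 1))

local notation "𝕍" => vbAux K q p Q n κ t_ b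

lemma prod_mul_prod_eq_vbAux (A : ℕ) :
    ((List.range A).map (fun i => vplus K q p Q n (bat κ b (A + 1 - i)) (bsum κ b (A + 1 - i - 1))
      (tsum κ t_ (A + 1 - i - 1)))).prod *
      ((List.range A).map (fun α => 𝕌 (tsum κ t_ (α + 1))
        (tsum κ t_ (α + 2) - tsum κ t_ (α + 1)) (bsum κ b (α + 1)))).prod = 𝕍 A := by
  induction A with
  | zero => simp [vbAux]
  | succ A ih =>
    rw [List.prod_range_succ', List.prod_range_succ, vbAux, ← ih, tsum_succ (A + 1),
      Nat.add_sub_cancel_left]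
    simp only [Nat.succ_eq_add_one, Nat.add_sub_add_right, mul_assoc]
    rfl

lemma vb_eq_vbAux (hκ : 0 < κ) : vb K q p Q n κ t_ b = 𝕍 (κ - 1) := by
  rw [← prod_mul_prod_eq_vbAux, Nat.sub_add_cancel hκ]
  rfl

lemma vbAux_mem_parabolic (A : ℕ) : 𝕍 A ∈ ℍ (bsum κ b (A + 1)) := by
  induction A with
  | zero => exact one_mem _
  | succ A ih =>
    have h : bsum κ b (A + 1 + 1) = bsum κ b (A + 1) + bat κ b (A + 2) := bsum_succ (A + 1)
    rw [vbAux, vplus_eq]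
    refine mul_mem (mul_mem (mul_mem (uProd_mem_parabolic _ _ (by omega)) ?_)
      (parabolic_mono (by omega) ih)) (uProd_mem_parabolic _ _ (by omega))
    rcases Nat.eq_zero_or_pos (bsum κ b (A + 1)) with h0 | h0
    · rw [h0, pow_zero]
      exact one_mem _
    · exact pow_mem (descProd_mem_parabolic (by omega)) _

lemma twist_uProd {ε : K} (hε : ε ^ p = 1) (hn : 0 < n) (s l m : ℕ) :
    twist hε hn (𝕌 s l m) = 𝕌 s l m := by
  simp only [uProd, uFactor, map_list_prod, List.map_map]
  congr 2
  funext k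
  simp only [Function.comp, map_list_prod, List.map_map]
  congr 2
  funext j
  simp [twist_Lm, smul_pow, hε]

lemma twist_descProd {ε : K} (hε : ε ^ p = 1) (hn : 0 < n) (k : ℕ) :
    twist hε hn (𝖣 k) = 𝖣 k := by
  induction k with
  | zero => exact map_one _
  | succ k ih => rw [descProd, map_mul, ih, twist_Tg hε hn (by omega)]

lemma twist_vbAux {ε : K} (hε : ε ^ p = 1) (hn : 0 < n) (A : ℕ) :
    twist hε hn (𝕍 A) = 𝕍 A := by
  induction A with
  | zero => exact map_one _
  | succ A ih =>
    rw [vbAux, vplus_eq, map_mul, map_mul, map_mul, map_pow, ih, twist_uProd, twist_uProd,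
      twist_descProd]

lemma uProd_mul_uProd_mul_uProd_eq_zero (hn : 0 < n) {s g r : ℕ} (h : s + g + r = t) :
    𝕌 (s + g) r 1 * 𝕌 0 s 1 * 𝕌 s g 1 = 0 := by
  have e := uProd_mul (q := q) (p := p) (Q := Q) (n := n) 0 s g 1
  have e' := uProd_mul (q := q) (p := p) (Q := Q) (n := n) 0 (s + g) r 1
  rw [zero_add] at e e'
  rw [mul_assoc, e, (commute_of_mem_murphyAlg (uProd_mem_murphyAlg _ _ hn)
    (uProd_mem_murphyAlg _ _ hn)).eq, e', h, uProd_cyclo hn]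

lemma Lm_one_mul_uProd_mul (hq : q ≠ 0) {s g r a c : ℕ} (h : s + g + r = t) (ha : 0 < a)
    (hac : a + c = n) :
    𝕃 1 * (𝕌 (s + g) r n * 𝕌 0 s a * 𝖣 (a + c - 1) ^ c * 𝕌 s g c) =
      𝕌 (s + g) r n * 𝕌 0 s a * 𝖣 (a + c - 1) ^ c * (𝕃 (c + 1) * 𝕌 s g c) := by
  have hn : 1 ≤ n := by omega
  have hL1 := Lm_mem_murphyAlg (q := q) (p := p) (Q := Q) le_rfl hn
  have hF : Commute (𝕌 (s + g) r n * 𝕌 0 s a) (𝕃 1) :=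
    commute_of_mem_murphyAlg (mul_mem (uProd_mem_murphyAlg _ _ le_rfl)
      (uProd_mem_murphyAlg _ _ (by omega))) hL1
  have hG : ∀ i, 1 ≤ i → i < c → Commute (𝕌 s g c) (𝕋 i) := fun i _ hi =>
    (Tg_commute_uProd hq _ _ (by omega) (by omega) (by omega)).symm
  rcases Nat.eq_zero_or_pos c with hc | hc
  · rw [← mul_one (𝕌 (s + g) r n * 𝕌 0 s a)] at hF ⊢
    exact Lm_one_mul_mul_descProd hq (fun _ _ _ => Commute.one_left _)
      (fun _ _ _ => Commute.one_left _) hF (by omega) (by omega) hG (fun h0 => by omega)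
  · obtain ⟨R, hR, e⟩ := exists_uProd_eq (q := q) (p := p) (Q := Q) (s + g) r hn (le_refl n)
    obtain ⟨R', hR', e'⟩ := exists_uProd_eq (q := q) (p := p) (Q := Q) 0 s ha (by omega : a ≤ n)
    obtain ⟨S, hS, eS⟩ := exists_uProd_eq (q := q) (p := p) (Q := Q) s g hc (by omega : c ≤ n)
    have hf : 𝕌 (s + g) r 1 * 𝕌 0 s 1 ∈ 𝓛 :=
      mul_mem (uProd_mem_murphyAlg _ _ hn) (uProd_mem_murphyAlg _ _ hn)
    have eF : 𝕌 (s + g) r n * 𝕌 0 s a = R * R' * (𝕌 (s + g) r 1 * 𝕌 0 s 1) := by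
      rw [e, e', mul_assoc, ← mul_assoc _ R',
        (commute_of_mem_murphyAlg (uProd_mem_murphyAlg _ _ hn) hR').eq]
      simp only [mul_assoc]
    rw [eF] at hF ⊢
    refine Lm_one_mul_mul_descProd hq (fun i hi hin => ?_)
      (fun j h1 hj => commute_of_mem_murphyAlg hf (Lm_mem_murphyAlg h1 hj)) hF
      (by omega) (by omega) hG (fun _ => ?_)
    · exact ((Tg_commute_uProd hq _ _ hn hin (by omega)).mul_right
        (Tg_commute_uProd hq _ _ hn hin (by omega))).symm
    · rw [eS, ← mul_assoc, (commute_of_mem_murphyAlg hf hS).eq, mul_assoc,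
        uProd_mul_uProd_mul_uProd_eq_zero hn h, mul_zero]

lemma exists_vbAux_mul_Lm (hq : q ≠ 0) (hp : 0 < p) (hn : 0 < n) (hQ : ∀ i, Q i ≠ 0) (A : ℕ)
    (hb : bsum κ b (A + 1) = n) (ht : tsum κ t_ (A + 1) ≤ t) :
    ∃ X, IsUnit X ∧ ∃ j, 1 ≤ j ∧ j ≤ n ∧
      𝕌 (tsum κ t_ (A + 1)) (t - tsum κ t_ (A + 1)) n * 𝕍 A * 𝕃 j =
        X * (𝕌 (tsum κ t_ (A + 1)) (t - tsum κ t_ (A + 1)) n * 𝕍 A) := by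
  induction A with
  | zero =>
    refine ⟨𝕃 1, isUnit_Lm hq hp hn hQ le_rfl, 1, le_rfl, hn, ?_⟩
    rw [vbAux, mul_one]
    exact commute_of_mem_murphyAlg (uProd_mem_murphyAlg _ _ le_rfl) (Lm_mem_murphyAlg le_rfl hn)
  | succ A ih =>
    have hV := vbAux_mem_parabolic (q := q) (p := p) (Q := Q) (n := n) (t_ := t_) (b := b) A
    rw [bsum_succ (A + 1)] at hb
    rw [tsum_succ (A + 1)] at ht ⊢
    rw [vbAux, vplus_eq]
    set c := bsum κ b (A + 1)
    set a := bat κ b (A + 2)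
    set s := tsum κ t_ (A + 1)
    set g := tat κ t_ (A + 2)
    have hVG : Commute (𝕌 s g c) (𝕍 A) := commute_of_mem_parabolic (fun i hi =>
      (Tg_commute_uProd hq _ _ (by omega) (by omega) (by omega)).symm) hV
    obtain ⟨r, hr⟩ := Nat.exists_eq_add_of_le ht
    have hr' : t - (s + g) = r := by omega
    rw [hr']
    rcases Nat.eq_zero_or_pos a with ha | ha
    · have hc : c = n := by omega
      obtain ⟨X, hX, j, h1, hj, e⟩ := ih hc (by omega)
      have hts : t - s = g + r := by omega
      rw [hts, ← uProd_mul, (commute_of_mem_murphyAlg (uProd_mem_murphyAlg s g le_rfl)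
        (uProd_mem_murphyAlg (s + g) r le_rfl)).eq, mul_assoc (𝕌 (s + g) r n)] at e
      rw [hc] at hVG
      have hD : Commute (𝕌 (s + g) r n) (𝖣 (n - 1) ^ n) :=
        (commute_descProd fun i hi hin =>
          (Tg_commute_uProd hq _ _ le_rfl (by omega) (by omega)).symm).pow_right _
      have hZ := (isUnit_descProd (p := p) (Q := Q) (n := n) hq (n - 1)).pow n
      obtain ⟨Z, hZ⟩ := hZ
      rw [ha, uProd_zero_right, one_mul, zero_add, hc, mul_assoc _ (𝕍 A), ← hVG.eq,
        ← mul_assoc (𝕌 (s + g) r n), hD.eq, ← hZ]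
      refine ⟨Z * X * (Z⁻¹ : _ˣ), (Z.isUnit.mul hX).mul (Z⁻¹).isUnit, j, h1, hj, ?_⟩
      rw [mul_assoc (Z : AK K q p Q n), mul_assoc (Z : AK K q p Q n), e]
      simp [mul_assoc]
    · refine ⟨𝕃 1, isUnit_Lm hq hp hn hQ le_rfl, c + 1, by omega, by omega, ?_⟩
      have hLV : Commute (𝕃 (c + 1)) (𝕍 A) := commute_of_mem_parabolic (fun i hi =>
        Lm_commute_Tg_of_gt (by omega) (by omega)) hV
      have hLG : Commute (𝕃 (c + 1)) (𝕌 s g c) := commute_of_mem_murphyAlg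
        (Lm_mem_murphyAlg (by omega) (by omega)) (uProd_mem_murphyAlg _ _ (by omega))
      have key := Lm_one_mul_uProd_mul (p := p) (Q := Q) (n := n) hq hr.symm ha
        (by omega : a + c = n)
      rw [mul_assoc _ (𝕍 A), ← hVG.eq]
      calc _ = 𝕌 (s + g) r n * 𝕌 0 s a * 𝖣 (a + c - 1) ^ c * 𝕌 s g c * (𝕍 A * 𝕃 (c + 1)) := by
            simp only [mul_assoc]
        _ = 𝕌 (s + g) r n * 𝕌 0 s a * 𝖣 (a + c - 1) ^ c * (𝕌 s g c * 𝕃 (c + 1)) * 𝕍 A := by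
            rw [← hLV.eq]
            simp only [mul_assoc]
        _ = 𝕃 1 * (𝕌 (s + g) r n * 𝕌 0 s a * 𝖣 (a + c - 1) ^ c * 𝕌 s g c) * 𝕍 A := by
            rw [← hLG.eq, key]
        _ = _ := by simp only [mul_assoc]

lemma pos_of_bsum_eq (hn : 0 < n) (hb : bsum κ b κ = n) : 0 < κ := by
  rcases Nat.eq_zero_or_pos κ with rfl | h
  · rw [bsum, Finset.Icc_eq_empty (by omega), Finset.sum_empty] at hb
    omega
  · exact h

/-- The element `v_b` intertwines a Murphy element with an invertible element. -/
lemma exists_vb_mul_Lm (hq : q ≠ 0) (hp : 0 < p) (hn : 0 < n) (hQ : ∀ i, Q i ≠ 0)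
    (ht : tsum κ t_ κ = t) (hb : bsum κ b κ = n) :
    ∃ X, IsUnit X ∧ ∃ j, 1 ≤ j ∧ vb K q p Q n κ t_ b * 𝕃 j = X * vb K q p Q n κ t_ b := by
  have hκ := pos_of_bsum_eq hn hb
  have e : κ - 1 + 1 = κ := by omega
  obtain ⟨X, hX, j, h1, -, h⟩ := exists_vbAux_mul_Lm (t_ := t_) (b := b) hq hp hn hQ (κ - 1)
    (by rw [e, hb]) (by rw [e, ht])
  rw [e, ht, Nat.sub_self, uProd_zero, one_mul, ← vb_eq_vbAux hκ] at h
  exact ⟨X, hX, j, h1, h⟩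

lemma twist_vb {ε : K} (hε : ε ^ p = 1) (hn : 0 < n) (hb : bsum κ b κ = n) :
    twist hε hn (vb K q p Q n κ t_ b) = vb K q p Q n κ t_ b := by
  rw [vb_eq_vbAux (pos_of_bsum_eq hn hb), twist_vbAux]

end intertwiner

end HuMathas

namespace HuMathas

section induction

variable {B' B : Type} [Ring B'] [Ring B] {ι : B' →+* B}
variable {M M' : Type} [AddCommGroup M] [Module B'ᵐᵒᵖ M] [AddCommGroup M'] [Module B'ᵐᵒᵖ M']
variable {N N' : Type} [AddCommGroup N] [AddCommGroup N'] [Module Bᵐᵒᵖ N'] [Module Bᵐᵒᵖ N]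

/-- A description of induced modules in terms of additive maps. -/
lemma isInducedFrom_iff :
    IsInducedFrom B' B ι M inferInstance N inferInstance ↔
      ∃ u : M →+ N, (∀ (a : B') m, u (MulOpposite.op a • m) = MulOpposite.op (ι a) • u m) ∧
        ∀ (P : Type) [AddCommGroup P] [Module Bᵐᵒᵖ P] (f : M →+ P),
          (∀ (a : B') m, f (MulOpposite.op a • m) = MulOpposite.op (ι a) • f m) →
          ∃! g : N →ₗ[Bᵐᵒᵖ] P, ∀ m, g (u m) = f m := by
  constructor
  · rintro ⟨u, hu⟩
    let _ : Module B'ᵐᵒᵖ N := Module.compHom N (RingHom.op ι)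
    refine ⟨u.toAddMonoidHom, fun a m => u.map_smul _ m, fun P _ _ f hf => ?_⟩
    let _ : Module B'ᵐᵒᵖ P := Module.compHom P (RingHom.op ι)
    exact hu P _ _ { f with map_smul' := fun a m => hf a.unop m }
  · rintro ⟨u, hu, h⟩
    let _ : Module B'ᵐᵒᵖ N := Module.compHom N (RingHom.op ι)
    refine ⟨{ u with map_smul' := fun a m => hu a.unop m }, fun P iP mP f => ?_⟩
    let _ : Module B'ᵐᵒᵖ P := Module.compHom P (RingHom.op ι)
    exact h P f.toAddMonoidHom fun a m => f.map_smul _ m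

lemma IsInducedFrom.nonempty_linearEquiv
    (h : IsInducedFrom B' B ι M inferInstance N inferInstance)
    (h' : IsInducedFrom B' B ι M inferInstance N' inferInstance) : Nonempty (N ≃ₗ[Bᵐᵒᵖ] N') := by
  obtain ⟨u, hu, h⟩ := isInducedFrom_iff.mp h
  obtain ⟨u', hu', h'⟩ := isInducedFrom_iff.mp h'
  obtain ⟨g, hg, -⟩ := h N' u' hu'
  obtain ⟨g', hg', -⟩ := h' N u hu
  refine ⟨LinearEquiv.ofLinearMap g g' ?_ ?_⟩
  · exact (h' N' u' hu').unique (fun m => by rw [LinearMap.comp_apply, hg', hg]) fun m => rfl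
  · exact (h N u hu).unique (fun m => by rw [LinearMap.comp_apply, hg, hg']) fun m => rfl

lemma IsInducedFrom.of_addEquiv (e : M ≃+ M')
    (he : ∀ (a : B') m, e (MulOpposite.op a • m) = MulOpposite.op a • e m)
    (h : IsInducedFrom B' B ι M' inferInstance N inferInstance) :
    IsInducedFrom B' B ι M inferInstance N inferInstance := by
  obtain ⟨u, hu, h⟩ := isInducedFrom_iff.mp h
  refine isInducedFrom_iff.mpr ⟨u.comp e, fun a m => ?_, fun P _ _ f hf => ?_⟩
  · simp [he, hu]
  · have hes : ∀ (a : B') m, e.symm (MulOpposite.op a • m) = MulOpposite.op a • e.symm m :=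
      fun a m => by rw [e.symm_apply_eq, he, e.apply_symm_apply]
    obtain ⟨g, hg, hg'⟩ := h P (f.comp e.symm) fun a m => by simp [hes, hf]
    refine ⟨g, fun m => by simp [hg], fun g₁ hg₁ => hg' _ fun m => ?_⟩
    simpa using hg₁ (e.symm m)

lemma IsInducedFrom.pi {p : ℕ} (h : IsInducedFrom B' B ι M inferInstance N inferInstance) :
    IsInducedFrom B' B ι (Fin p → M) inferInstance (Fin p → N) inferInstance := by
  obtain ⟨u, hu, h⟩ := isInducedFrom_iff.mp h
  refine isInducedFrom_iff.mpr ⟨u.compLeft (Fin p), fun a m => ?_, fun P _ _ f hf => ?_⟩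
  · funext i
    exact hu a (m i)
  · have hfi : ∀ (i : Fin p) (a : B') m, (f.comp (AddMonoidHom.single (fun _ => M) i))
        (MulOpposite.op a • m) =
          MulOpposite.op (ι a) • (f.comp (AddMonoidHom.single (fun _ => M) i)) m := by
      intro i a m
      simp only [AddMonoidHom.comp_apply, AddMonoidHom.single_apply]
      rw [← hf, Pi.single_smul]
    choose g hg hg' using fun i => h P (f.comp (AddMonoidHom.single (fun _ => M) i)) (hfi i)
    refine ⟨∑ i, g i ∘ₗ LinearMap.proj i, fun m => ?_, fun g₁ hg₁ => ?_⟩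
    · have e : f m = ∑ i, f (Pi.single i (m i)) := by
        rw [← map_sum, Finset.univ_sum_single]
      rw [e, LinearMap.sum_apply]
      exact Finset.sum_congr rfl fun i _ => hg i (m i)
    · refine LinearMap.pi_ext' fun i => ?_
      have e1 : g₁ ∘ₗ LinearMap.single Bᵐᵒᵖ (fun _ => N) i = g i := by
        refine hg' i _ fun m => ?_
        rw [AddMonoidHom.comp_apply, ← hg₁]
        refine congrArg g₁ (funext fun j => ?_)
        exact (Pi.apply_single (fun _ => u) (fun _ => map_zero u) i m j).symm
      rw [e1]
      ext m
      simp only [LinearMap.comp_apply, LinearMap.sum_apply, LinearMap.single_apply,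
        LinearMap.proj_apply]
      rw [Finset.sum_eq_single i (fun j _ hj => by rw [Pi.single_eq_of_ne hj, map_zero])
        (fun h => absurd (Finset.mem_univ i) h), Pi.single_eq_same]

end induction

end HuMathas

namespace HuMathas

section ideals

variable {K : Type} [Field K] {q : K} {p : ℕ} {t : ℕ} {Q : Fin t → K} {n : ℕ} {ε : K}

local notation "ℋ" => AK K q p Q n
local notation "𝕋" => Tg K q p Q n
local notation "𝔸" => AKp K q p Q n

/-- Left multiplication by `v`, as a map from `H_{r,p,n}` to `v H_{r,p,n}`. -/
def mulP (v : ℋ) : 𝔸 →+ rIdealP K q p Q n v where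
  toFun c := ⟨v * c, c, c.2, rfl⟩
  map_zero' := Subtype.ext (mul_zero v)
  map_add' c d := Subtype.ext (mul_add v (c : ℋ) d)

lemma mulP_surjective (v : ℋ) : Function.Surjective (mulP v) := fun ⟨_, c, hc, e⟩ =>
  ⟨⟨c, hc⟩, Subtype.ext e.symm⟩

lemma coe_op_smul_rIdeal {v : ℋ} (a : ℋ) (x : rIdeal K q p Q n v) :
    ((MulOpposite.op a • x : rIdeal K q p Q n v) : ℋ) = x * a := rfl

lemma mulP_mul (v : ℋ) (c a : 𝔸) : mulP v (c * a) = MulOpposite.op a • mulP v c :=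
  Subtype.ext (mul_assoc v (c : ℋ) a).symm

/-- The inclusion of `v H_{r,p,n}` into `v H_{r,n}`. -/
def rIdealPIncl (v : ℋ) : rIdealP K q p Q n v →+ rIdeal K q p Q n v where
  toFun x := ⟨x, let ⟨h, _, e⟩ := x.2; ⟨h, e⟩⟩
  map_zero' := rfl
  map_add' _ _ := rfl

lemma rIdealPIncl_smul {v : ℋ} (a : 𝔸) (x : rIdealP K q p Q n v) :
    rIdealPIncl v (MulOpposite.op a • x) = MulOpposite.op (a : ℋ) • rIdealPIncl v x := rfl

lemma mulP_eq_zero (hε : IsPrimitiveRoot ε p) (hp : 0 < p) (hn : 0 < n) (hQ : ∀ i, Q i ≠ 0)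
    {v : ℋ} (hv : twist hε.pow_eq_one hn v = v) {c : Fin p → 𝔸}
    (h : v * ∑ i, (c i : ℋ) * 𝕋 0 ^ i.1 = 0) (i : Fin p) : mulP v (c i) = 0 := by
  rw [Finset.mul_sum] at h
  have h0 := eq_zero_of_sum_eigenvectors (twist hε.pow_eq_one hn).toLinearMap hε
    (x := fun i => v * ((c i : ℋ) * 𝕋 0 ^ i.1)) (fun i => ?_) h i
  · rw [← mul_assoc] at h0
    exact Subtype.ext ((((isUnit_Tg_zero hp hn hQ).pow i.1).mul_left_eq_zero).mp h0)
  · rw [AlgHom.toLinearMap_apply, map_mul, hv,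
      twist_mul_Tg_zero_pow hε.pow_eq_one hp hn hQ, mul_smul_comm]

/-- `v H_{r,n}` is induced from `v H_{r,p,n}` when `v` is fixed by the twist automorphism. -/
lemma isInducedFrom_rIdealP (hε : IsPrimitiveRoot ε p) (hq : q ≠ 0) (hp : 0 < p) (hn : 1 < n)
    (hQ : ∀ i, Q i ≠ 0) {v : ℋ} (hv : twist hε.pow_eq_one (zero_lt_one.trans hn) v = v) :
    IsInducedFrom 𝔸 ℋ (AKp K q p Q n).val.toRingHom (rIdealP K q p Q n v) inferInstance
      (rIdeal K q p Q n v) inferInstance := by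
  refine isInducedFrom_iff.mpr ⟨rIdealPIncl v, rIdealPIncl_smul, fun P _ _ f hf => ?_⟩
  have hdec : ∀ x : rIdeal K q p Q n v, ∃ c : Fin p → 𝔸,
      (x : ℋ) = v * ∑ i, (c i : ℋ) * 𝕋 0 ^ i.1 := by
    rintro ⟨x, h, e⟩
    obtain ⟨c, hc⟩ := exists_eq_sum_fin_mul_Tg_zero_pow hq hp hn hQ h
    exact ⟨c, by rw [← hc, ← e]⟩
  choose c hc using hdec
  set G : (Fin p → 𝔸) → P := fun d => ∑ i, MulOpposite.op (𝕋 0 ^ i.1) • f (mulP v (d i)) with hG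
  have hwd : ∀ (x : rIdeal K q p Q n v) (d : Fin p → 𝔸),
      (x : ℋ) = v * ∑ i, (d i : ℋ) * 𝕋 0 ^ i.1 → G (c x) = G d := by
    intro x d hd
    refine Finset.sum_congr rfl fun i _ => ?_
    have h0 := mulP_eq_zero hε hp (zero_lt_one.trans hn) hQ hv (c := c x - d) ?_ i
    · rw [Pi.sub_apply, map_sub, sub_eq_zero] at h0
      rw [h0]
    · simp only [Pi.sub_apply, AddSubgroupClass.coe_sub, sub_mul, Finset.sum_sub_distrib, mul_sub]
      rw [← hc, ← hd, sub_self]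
  have hadd : ∀ x y, G (c (x + y)) = G (c x) + G (c y) := by
    intro x y
    rw [hwd (x + y) (c x + c y)]
    · simp only [hG, Pi.add_apply, map_add, smul_add, Finset.sum_add_distrib]
    · simp only [Pi.add_apply, Subalgebra.coe_add, add_mul, Finset.sum_add_distrib, mul_add]
      rw [← hc, ← hc]
      rfl
  have hsmul : ∀ (h : ℋ) x, G (c (MulOpposite.op h • x)) = MulOpposite.op h • G (c x) := by
    intro h x
    choose d hd using fun i : Fin p =>
      exists_eq_sum_fin_mul_Tg_zero_pow hq hp hn hQ (𝕋 0 ^ i.1 * h)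
    rw [hwd _ fun j => ∑ i, c x i * d i j]
    · simp only [hG, map_sum, mulP_mul, hf, Finset.smul_sum]
      rw [Finset.sum_comm]
      refine Finset.sum_congr rfl fun i _ => ?_
      rw [smul_smul, ← MulOpposite.op_mul, hd i, Finset.op_sum, Finset.sum_smul]
      refine Finset.sum_congr rfl fun j _ => ?_
      rw [smul_smul, MulOpposite.op_mul]
      rfl
    · rw [coe_op_smul_rIdeal, hc x, mul_assoc, Finset.sum_mul]
      simp only [AddSubmonoidClass.coe_finsetSum, Subalgebra.coe_mul, Finset.sum_mul, mul_assoc,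
        hd, Finset.mul_sum]
      rw [Finset.sum_comm]
  refine ⟨{ toFun := fun x => G (c x), map_add' := hadd,
            map_smul' := fun h x => hsmul h.unop x }, fun m => ?_, fun g hg => ?_⟩
  · obtain ⟨a, rfl⟩ := mulP_surjective v m
    change G _ = _
    rw [hwd _ (Pi.single ⟨0, hp⟩ a)]
    · rw [hG]
      simp only
      rw [Finset.sum_eq_single ⟨0, hp⟩ (fun j _ hj => by
        rw [Pi.single_eq_of_ne hj, map_zero, map_zero, smul_zero])
        (fun h => absurd (Finset.mem_univ _) h), Pi.single_eq_same, pow_zero, MulOpposite.op_one,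
        one_smul]
    · rw [Finset.sum_eq_single ⟨0, hp⟩ (fun j _ hj => by
        rw [Pi.single_eq_of_ne hj, ZeroMemClass.coe_zero, zero_mul])
        (fun h => absurd (Finset.mem_univ _) h), Pi.single_eq_same, pow_zero, mul_one]
      rfl
  · ext x
    have hx : x = ∑ i : Fin p, MulOpposite.op (𝕋 0 ^ i.1) • rIdealPIncl v (mulP v (c x i)) := by
      refine Subtype.ext ?_
      rw [hc x, Finset.mul_sum, AddSubmonoidClass.coe_finsetSum]
      exact Finset.sum_congr rfl fun i _ => (mul_assoc _ _ _).symm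
    conv_lhs => rw [hx]
    simp only [map_sum, map_smul, hg]
    rfl

/-- The restriction of `v H_{r,n}` is a direct sum of copies of `v H_{r,p,n}` when `v` is fixed by
the twist automorphism and intertwines a unit of degree one with another unit. -/
lemma exists_addEquiv_rIdealP (hε : IsPrimitiveRoot ε p) (hq : q ≠ 0) (hp : 0 < p) (hn : 1 < n)
    (hQ : ∀ i, Q i ≠ 0) {v X Y : ℋ} (hv : twist hε.pow_eq_one (zero_lt_one.trans hn) v = v)
    (hX : IsUnit X) (hY : IsUnit Y) (hYt : twist hε.pow_eq_one (zero_lt_one.trans hn) Y = ε • Y)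
    (hXY : v * Y = X * v) :
    ∃ e : rIdeal K q p Q n v ≃+ (Fin p → rIdealP K q p Q n v),
      ∀ (a : 𝔸) x, e (MulOpposite.op (a : ℋ) • x) = MulOpposite.op a • e x := by
  have hpow : ∀ i : ℕ, X ^ i * v = v * Y ^ i := fun i =>
    ((show SemiconjBy v Y X from hXY).pow_right i).eq.symm
  have hYtp : ∀ i : ℕ, twist hε.pow_eq_one (zero_lt_one.trans hn) (Y ^ i) = ε ^ i • Y ^ i :=
    fun i => by rw [map_pow, hYt, smul_pow]
  let φ : (Fin p → rIdealP K q p Q n v) →+ rIdeal K q p Q n v :=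
    { toFun := fun x => ⟨∑ i, X ^ i.1 * (x i : ℋ), sum_mem fun i _ => by
        obtain ⟨h, -, e⟩ := (x i).2
        exact ⟨Y ^ i.1 * h, by rw [e, ← mul_assoc, hpow, mul_assoc]⟩⟩
      map_zero' := Subtype.ext (by simp)
      map_add' := fun x y => Subtype.ext (by simp [mul_add, Finset.sum_add_distrib]) }
  have hφs : ∀ (a : 𝔸) x, φ (MulOpposite.op a • x) = MulOpposite.op (a : ℋ) • φ x := by
    intro a x
    refine Subtype.ext ?_
    rw [coe_op_smul_rIdeal]
    change ∑ i, X ^ i.1 * ((x i : ℋ) * a) = (∑ i, X ^ i.1 * (x i : ℋ)) * a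
    simp only [Finset.sum_mul, mul_assoc]
  have hinj : Function.Injective φ := by
    rw [injective_iff_map_eq_zero]
    intro x hx
    funext i
    have h0 := eq_zero_of_sum_eigenvectors
      (twist hε.pow_eq_one (zero_lt_one.trans hn)).toLinearMap hε
      (x := fun i => X ^ i.1 * (x i : ℋ)) (fun i => ?_) (congrArg Subtype.val hx) i
    · exact Subtype.ext (((hX.pow i.1).mul_right_eq_zero).mp h0)
    · obtain ⟨h, hh, e⟩ := (x i).2
      rw [e, ← mul_assoc, hpow, AlgHom.toLinearMap_apply, map_mul, map_mul, hv, hYtp,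
        twist_of_mem_AKp hε.pow_eq_one hp (zero_lt_one.trans hn) hQ hh, mul_smul_comm,
        smul_mul_assoc]
  have hsurj : Function.Surjective φ := by
    rintro ⟨_, h, rfl⟩
    obtain ⟨c, hc⟩ := exists_eq_sum_fin_mul_Tg_zero_pow hq hp hn hQ h
    have hd : ∀ i : Fin p, ∃ d : 𝔸, Y ^ i.1 * d = (c i : ℋ) * 𝕋 0 ^ i.1 := by
      intro i
      obtain ⟨Z, hZ⟩ := hY.pow i.1
      refine ⟨⟨(Z⁻¹ : ℋˣ) * ((c i : ℋ) * 𝕋 0 ^ i.1),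
        mem_AKp_of_twist_eq hε hq hp hn hQ ?_⟩, by rw [← hZ, Units.mul_inv_cancel_left]⟩
      have hεi : ε ^ i.1 ≠ 0 := pow_ne_zero _ (hε.ne_zero hp.ne')
      have hcan : ∀ x y : ℋ, ε ^ i.1 • (Y ^ i.1 * x) = ε ^ i.1 • (Y ^ i.1 * y) → x = y := by
        intro x y hxy
        exact (hY.pow i.1).mul_left_cancel (smul_right_injective _ hεi hxy)
      refine hcan _ _ ?_
      rw [← smul_mul_assoc, ← hYtp, ← map_mul, ← hZ, Units.mul_inv_cancel_left,
        twist_mul_Tg_zero_pow hε.pow_eq_one hp (zero_lt_one.trans hn) hQ]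
    choose d hd using hd
    refine ⟨fun i => mulP v (d i), Subtype.ext ?_⟩
    change ∑ i : Fin p, X ^ i.1 * (v * (d i : ℋ)) = v * h
    rw [hc, Finset.mul_sum]
    exact Finset.sum_congr rfl fun i _ => by rw [← mul_assoc, hpow, mul_assoc, hd]
  refine ⟨(AddEquiv.ofBijective φ ⟨hinj, hsurj⟩).symm, fun a x => ?_⟩
  rw [AddEquiv.symm_apply_eq]
  change _ = φ _
  rw [hφs]
  exact congrArg _ ((AddEquiv.ofBijective φ ⟨hinj, hsurj⟩).apply_symm_apply x).symm

end ideals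

end HuMathas

open HuMathas in
/-- **Statement 12** (Corollary `4lm`).  For every `b ∈ Λ(n,κ)`:
(a) `v_b H_{r,n} ≅ (v_b H_{r,p,n}) ⊗_{H_{r,p,n}} H_{r,n}` as (right) `H_{r,n}`-modules
    (expressed via the universal property of induction);
(b) the restriction of `v_b H_{r,n}` to `H_{r,p,n}` is isomorphic to `(v_b H_{r,p,n})^{⊕p}`;
(c) inducing the restriction of `v_b H_{r,n}` back up to `H_{r,n}` yields
    `(v_b H_{r,n})^{⊕p}`. -/
theorem vb_ind_res
    (K : Type) [Field K] [IsAlgClosed K]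
    (p t n κ : ℕ) (hp : 1 < p) (hn : 3 ≤ n) (ht : 0 < t)
    (ε q : K) (hε : IsPrimitiveRoot ε p) (hq : q ≠ 0)
    (Q : Fin t → K) (hQ : ∀ i, Q i ≠ 0)
    (t_ : Fin κ → ℕ) (horb : OrbitPartition ε q Q κ t_)
    (b : Fin κ → ℕ) (hb : IsComp n κ b) :
    -- (a)
    IsInducedFrom (↥(AKp K q p Q n)) (AK K q p Q n) ((AKp K q p Q n).val.toRingHom)
      (↥(rIdealP K q p Q n (vb K q p Q n κ t_ b))) inferInstance
      (↥(rIdeal K q p Q n (vb K q p Q n κ t_ b))) inferInstance ∧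
    -- (b)
    Nonempty (RLinEquiv (↥(AKp K q p Q n))ᵐᵒᵖ
      (↥(rIdeal K q p Q n (vb K q p Q n κ t_ b)))
      (Fin p → ↥(rIdealP K q p Q n (vb K q p Q n κ t_ b)))
      (Module.compHom _ (inclOp K q p Q n)) inferInstance) ∧
    -- (c)
    (∀ (N : Type) (_ : AddCommGroup N) (mN : Module (AK K q p Q n)ᵐᵒᵖ N),
      IsInducedFrom (↥(AKp K q p Q n)) (AK K q p Q n) ((AKp K q p Q n).val.toRingHom)
        (↥(rIdeal K q p Q n (vb K q p Q n κ t_ b)))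
        (Module.compHom _ (inclOp K q p Q n)) N mN →
      Nonempty (RLinEquiv (AK K q p Q n)ᵐᵒᵖ N
        (Fin p → ↥(rIdeal K q p Q n (vb K q p Q n κ t_ b))) mN inferInstance)) := by
  obtain ⟨X, hX, j, hj, hXY⟩ :=
    exists_vb_mul_Lm (p := p) hq (by omega) (by omega) hQ horb.1 hb
  have hv := twist_vb (q := q) (Q := Q) (t_ := t_) hε.pow_eq_one (by omega) hb
  have h := isInducedFrom_rIdealP hε hq (by omega) (by omega) hQ hv
  obtain ⟨e, he⟩ := exists_addEquiv_rIdealP hε hq (by omega) (by omega) hQ hv hX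
    (isUnit_Lm hq (by omega) (by omega) hQ hj) (twist_Lm hε.pow_eq_one (by omega) hj) hXY
  refine ⟨h, ?_, fun N _ _ hN => ?_⟩
  · let _ : Module (AKp K q p Q n)ᵐᵒᵖ (rIdeal K q p Q n (vb K q p Q n κ t_ b)) :=
      Module.compHom _ (inclOp K q p Q n)
    exact ⟨{ e with map_smul' := fun a x => he a.unop x }⟩
  · let _ : Module (AKp K q p Q n)ᵐᵒᵖ (rIdeal K q p Q n (vb K q p Q n κ t_ b)) :=
      Module.compHom _ (inclOp K q p Q n)
    exact hN.nonempty_linearEquiv (h.pi.of_addEquiv e he)
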